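/- arXiv:1712.01009 — 2 statements merged into one kernel-verified Lean document; each statement's English description precedes it below -/
import Mathlib

section
/- In the rank-2 hyperbolic setting with λ = Λ₁ − Λ₂: the crystal B(λ) of LS paths of shape λ is connected; that is, for every π ∈ B(λ) there exist k ≥ 0, indices i₁, …, i_k ∈ {1, 2}, and operators x̃_{i_q} ∈ {ẽ_{i_q}, f̃_{i_q}} such that π = x̃_{i_k} ⋯ x̃_{i_1}π_λ. -/
open scoped Classical
noncomputable section

namespace LSPaper

/-- The clamp of a real number to the interval `[0,1]`; paths `[0,1] → V` are
encoded as functions `ℝ → V` that factor through this clamp. -/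
def clamp01 (t : ℝ) : ℝ := max 0 (min 1 t)

variable {V : Type*} [AddCommGroup V] [Module ℝ V]

/-- The straight-line path `π_ν(t) = t ν` (clamped outside `[0,1]`). -/
def straight (ν : V) : ℝ → V := fun t => clamp01 t • ν

/-- The dilation `(mπ)(t) = m • π(t)`. -/
def dilate (m : ℕ) (f : ℝ → V) : ℝ → V := fun t => (m : ℝ) • f t

/-- The concatenation `π_1 * ⋯ * π_m` of a list of paths:
`(π_1 * ⋯ * π_m)(t) = Σ_{l<k} π_l(1) + π_k(mt - k + 1)` for
`(k-1)/m ≤ t ≤ k/m`. -/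
def concatList (l : List (ℝ → V)) : ℝ → V := fun t =>
  let m := l.length
  let k : ℕ := max 1 (min m (⌈(m : ℝ) * t⌉.toNat))
  (((l.take (k - 1)).map fun f => f 1).sum) +
    (l.getD (k - 1) 0) ((m : ℝ) * t - ((k : ℝ) - 1))

/-- Subdivision of a path into `m` pieces:
`π_k(t) = π(t/m + (k-1)/m) - π((k-1)/m)` (here `k` runs over `0, …, m-1`). -/
def subdiv (m : ℕ) (f : ℝ → V) : List (ℝ → V) :=
  List.ofFn fun k : Fin m => fun t : ℝ =>
    f ((clamp01 t + (k : ℝ)) / m) - f ((k : ℝ) / m)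

/-- The map `Σ_m : B(μ) → B(μ)^{⊗m}` (tensor factors encoded as a list):
dilate by `m`, then subdivide into `m` pieces. -/
def SigmaMap (m : ℕ) (f : ℝ → V) : List (ℝ → V) := subdiv m (dilate m f)

/-- The weight of a tensor product (encoded as a list of paths): the sum of
the weights of the factors. -/
def tensWt (l : List (ℝ → V)) : V := (l.map fun f => f 1).sum

/-- A symmetrizable generalized Cartan matrix together with a realization:
an integral weight lattice `P` inside a real vector space `V`, linearly
independent simple roots `α i ∈ P` and simple coroots (as linear functionals)
with `⟨α j, α i∨⟩ = a i j`, taking integer values on `P`. -/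
structure KacMoodyData (I : Type*) (V : Type*) [Fintype I] [DecidableEq I]
    [AddCommGroup V] [Module ℝ V] where
  a : I → I → ℤ
  d : I → ℤ
  P : AddSubgroup V
  α : I → V
  coroot : I → V →ₗ[ℝ] ℝ
  diag : ∀ i, a i i = 2
  offDiag : ∀ i j, i ≠ j → a i j ≤ 0
  zeroIff : ∀ i j, a i j = 0 ↔ a j i = 0
  dPos : ∀ i, 0 < d i
  symmetrizable : ∀ i j, d i * a i j = d j * a j i
  cartanPairing : ∀ i j, coroot i (α j) = (a i j : ℝ)
  rootsIndep : LinearIndependent ℝ α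
  corootsIndep : LinearIndependent ℝ coroot
  rootMem : ∀ i, α i ∈ P
  pairingInt : ∀ i, ∀ v ∈ P, ∃ n : ℤ, coroot i v = (n : ℝ)
  latticeFree : ∃ n : ℕ, Nonempty (P ≃+ (Fin n → ℤ))

namespace KacMoodyData

variable {I : Type*} [Fintype I] [DecidableEq I]
variable (K : KacMoodyData I V)

/-- The simple reflection `r_i(x) = x - ⟨x, α_i∨⟩ α_i` as a linear map. -/
def reflMap (i : I) : V →ₗ[ℝ] V := LinearMap.id - (K.coroot i).smulRight (K.α i)

lemma reflMap_invol (i : I) : Function.Involutive (K.reflMap i) := by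
  intro x
  have h2 : K.coroot i (K.α i) = 2 := by
    have h := K.cartanPairing i i
    rw [K.diag i] at h
    simpa using h
  simp only [reflMap, LinearMap.sub_apply, LinearMap.id_apply, LinearMap.smulRight_apply,
    map_sub, map_smul, smul_eq_mul, h2]
  module

/-- The simple reflection `r_i` as a linear automorphism of `V`. -/
def refl (i : I) : V ≃ₗ[ℝ] V :=
  { K.reflMap i with
    invFun := K.reflMap i
    left_inv := K.reflMap_invol i
    right_inv := K.reflMap_invol i }

/-- The Weyl group `W`, generated by the simple reflections. -/
def weylGroup : Subgroup (V ≃ₗ[ℝ] V) := Subgroup.closure (Set.range K.refl)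

/-- The Weyl group orbit `W μ` of an integral weight. -/
def orbit (μ : V) : Set V := {ν | ∃ w ∈ K.weylGroup, ν = w μ}

/-- `Q_+ = Σ_i ℤ_{≥0} α_i`. -/
def Qplus : Set V := {v | ∃ c : I → ℕ, v = ∑ i, (c i : ℝ) • K.α i}

/-- One step of the order on a Weyl group orbit:  `ν' = r_β(ν)` for a positive
real root `β = w α_i ∈ Q_+` (with `β∨ = w α_i∨`, `r_β = w r_i w⁻¹`) such that
`⟨ν, β∨⟩ < 0`. -/
def StepDown (ν ν' : V) : Prop :=
  ∃ w ∈ K.weylGroup, ∃ i : I, w (K.α i) ∈ K.Qplus ∧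
    K.coroot i (w.symm ν) < 0 ∧ ν' = w (K.refl i (w.symm ν))

/-- There is a chain `ν = ξ_0, ξ_1, …, ξ_p = ν'` of steps down. -/
def chainLen (p : ℕ) (ν ν' : V) : Prop :=
  ∃ ξ : ℕ → V, ξ 0 = ν ∧ ξ p = ν' ∧ ∀ q < p, K.StepDown (ξ q) (ξ (q + 1))

/-- `dist(ν, ν')`: the maximal length of a chain from `ν` down to `ν'`. -/
def dist (ν ν' : V) : ℕ := sSup {p | K.chainLen p ν ν'}

/-- A `σ`-chain for `(ν, ν')`: a sequence `ν = ξ_0 > ξ_1 > ⋯ > ξ_p = ν'` with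
`dist(ξ_{q-1}, ξ_q) = 1` and `σ ⟨ξ_{q-1}, β_q∨⟩ ∈ ℤ_{<0}`, where `β_q` is the
positive real root with `ξ_q = r_{β_q} ξ_{q-1}`. -/
def SigmaChain (σ : ℚ) (ν ν' : V) : Prop :=
  ∃ p : ℕ, 0 < p ∧ ∃ ξ : ℕ → V, ξ 0 = ν ∧ ξ p = ν' ∧
    ∀ q < p, K.dist (ξ q) (ξ (q + 1)) = 1 ∧
      ∃ w ∈ K.weylGroup, ∃ i : I, w (K.α i) ∈ K.Qplus ∧
        ξ (q + 1) = w (K.refl i (w.symm (ξ q))) ∧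
        ∃ n : ℤ, n < 0 ∧ (σ : ℝ) * K.coroot i (w.symm (ξ q)) = (n : ℝ)

/-- The combinatorial datum of a Lakshmibai–Seshadri path of shape `μ`:
a strictly decreasing sequence `ν_1 > ν_2 > ⋯ > ν_s` in `W μ` together with
rationals `0 = σ_0 < σ_1 < ⋯ < σ_s = 1` admitting `σ_u`-chains (the `ν`'s are
indexed here by `Fin s`, i.e. `0, …, s-1`). -/
structure LSData (K : KacMoodyData I V) (μ : V) where
  s : ℕ
  spos : 0 < s
  ν : Fin s → V
  τ : Fin (s + 1) → ℚ
  mem : ∀ u, ν u ∈ K.orbit μ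
  strictDec : ∀ (u : ℕ) (h : u + 1 < s),
    Relation.TransGen K.StepDown (ν ⟨u, Nat.lt_of_succ_lt h⟩) (ν ⟨u + 1, h⟩)
  τ_zero : τ 0 = 0
  τ_last : τ (Fin.last s) = 1
  τ_mono : StrictMono τ
  chainCond : ∀ (u : ℕ) (h : u + 1 < s),
    K.SigmaChain (τ ⟨u + 1, Nat.lt_succ_of_lt h⟩) (ν ⟨u, Nat.lt_of_succ_lt h⟩) (ν ⟨u + 1, h⟩)

/-- The piecewise-linear path `[0,1] → ℝ ⊗ P` associated with an LS datum:
`π(t) = Σ_{k<u} (σ_k - σ_{k-1}) ν_k + (t - σ_{u-1}) ν_u` for `σ_{u-1} ≤ t ≤ σ_u`,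
encoded as the function `ℝ → V`, `t ↦ Σ_k (min t σ_{k+1} - min t σ_k) • ν_k`
(which is constant for `t ≤ 0` and `t ≥ 1`). -/
def LSData.path {K : KacMoodyData I V} {μ : V} (π : K.LSData μ) : ℝ → V := fun t =>
  ∑ k : Fin π.s,
    ((min t ((π.τ k.succ : ℚ) : ℝ)) - (min t ((π.τ k.castSucc : ℚ) : ℝ))) • π.ν k

/-- `B(μ)`: the set of Lakshmibai–Seshadri paths of shape `μ`. -/
def B (μ : V) : Set (ℝ → V) := {f | ∃ π : K.LSData μ, f = π.path}

/-- `H_i^π(t) = ⟨π(t), α_i∨⟩`. -/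
def H (i : I) (f : ℝ → V) : ℝ → ℝ := fun t => K.coroot i (f t)

/-- `m_i^π = min {H_i^π(t) : t ∈ [0,1]}`. -/
def mval (i : I) (f : ℝ → V) : ℝ := sInf (K.H i f '' Set.Icc 0 1)

/-- The raising root operator `ẽ_i` (the underlying path, before testing
whether it is defined): with `t_1 = min {t : H_i^π(t) = m_i^π}` and
`t_0 = max {t ≤ t_1 : H_i^π(t) = m_i^π + 1}`, the new path is `π(t)` for
`t ≤ t_0`, `r_i(π(t) - π(t_0)) + π(t_0)` for `t_0 ≤ t ≤ t_1` and `π(t) + α_i`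
for `t ≥ t_1`. -/
def eraw (i : I) (f : ℝ → V) : ℝ → V := fun t =>
  let m := K.mval i f
  let t1 := sInf {t | t ∈ Set.Icc (0 : ℝ) 1 ∧ K.H i f t = m}
  let t0 := sSup {t | t ∈ Set.Icc (0 : ℝ) t1 ∧ K.H i f t = m + 1}
  if t ≤ t0 then f t
  else if t ≤ t1 then K.refl i (f t - f t0) + f t0
  else f t + K.α i

/-- The lowering root operator `f̃_i` (the underlying path): with
`t_0 = max {t : H_i^π(t) = m_i^π}` and `t_1 = min {t ≥ t_0 : H_i^π(t) = m_i^π + 1}`,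
the new path is `π(t)` for `t ≤ t_0`, `r_i(π(t) - π(t_0)) + π(t_0)` for
`t_0 ≤ t ≤ t_1` and `π(t) - α_i` for `t ≥ t_1`. -/
def fraw (i : I) (f : ℝ → V) : ℝ → V := fun t =>
  let m := K.mval i f
  let t0 := sSup {t | t ∈ Set.Icc (0 : ℝ) 1 ∧ K.H i f t = m}
  let t1 := sInf {t | t ∈ Set.Icc t0 1 ∧ K.H i f t = m + 1}
  if t ≤ t0 then f t
  else if t ≤ t1 then K.refl i (f t - f t0) + f t0
  else f t - K.α i

/-- The root operator `ẽ_i`, with value `none` (the formal element `0`) when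
`m_i^π = 0`. -/
def eop (i : I) (f : ℝ → V) : Option (ℝ → V) :=
  if K.mval i f = 0 then none else some (K.eraw i f)

/-- The root operator `f̃_i`, with value `none` (the formal element `0`) when
`H_i^π(1) - m_i^π = 0`. -/
def fop (i : I) (f : ℝ → V) : Option (ℝ → V) :=
  if K.H i f 1 - K.mval i f = 0 then none else some (K.fraw i f)

/-- `ẽ_i^n π` (with `ẽ_i 0 = 0`). -/
def eIter (i : I) (n : ℕ) (f : ℝ → V) : Option (ℝ → V) :=
  (fun o => o.bind (K.eop i))^[n] (some f)

/-- `f̃_i^n π` (with `f̃_i 0 = 0`). -/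
def fIter (i : I) (n : ℕ) (f : ℝ → V) : Option (ℝ → V) :=
  (fun o => o.bind (K.fop i))^[n] (some f)

/-- `ε_i(π) = max {n ≥ 0 : ẽ_i^n π ≠ 0}`. -/
def epsilon (i : I) (f : ℝ → V) : ℕ := sSup {n | K.eIter i n f ≠ none}

/-- `φ_i(π) = max {n ≥ 0 : f̃_i^n π ≠ 0}`. -/
def phi (i : I) (f : ℝ → V) : ℕ := sSup {n | K.fIter i n f ≠ none}

/-- The Weyl group action on a normal crystal:
`S_i b = f̃_i^{⟨wt b, α_i∨⟩} b` if `⟨wt b, α_i∨⟩ ≥ 0` and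
`S_i b = ẽ_i^{-⟨wt b, α_i∨⟩} b` if `⟨wt b, α_i∨⟩ ≤ 0`. -/
def Sop (i : I) (f : ℝ → V) : Option (ℝ → V) :=
  if 0 ≤ K.coroot i (f 1) then K.fIter i (⌊K.coroot i (f 1)⌋.toNat) f
  else K.eIter i ((-⌊K.coroot i (f 1)⌋).toNat) f

/-- `SWord K [i₁, …, i_k] b = S_{i₁} S_{i₂} ⋯ S_{i_k} b`. -/
def SWord (K : KacMoodyData I V) : List I → Option (ℝ → V) → Option (ℝ → V)
  | [], o => o
  | i :: rest, o => (SWord K rest o).bind (K.Sop i)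

/-- `b` is extremal: for each `w ∈ W` (as a word in simple reflections) and
`i ∈ I`, `ẽ_i (S_w b) = 0` if `⟨wt (S_w b), α_i∨⟩ ≥ 0` and `f̃_i (S_w b) = 0`
if `⟨wt (S_w b), α_i∨⟩ ≤ 0`. -/
def Extremal (f : ℝ → V) : Prop :=
  ∀ (l : List I) (g : ℝ → V), K.SWord l (some f) = some g →
    ∀ i : I, (0 ≤ K.coroot i (g 1) → K.eop i g = none) ∧
      (K.coroot i (g 1) ≤ 0 → K.fop i g = none)

/-- Application of a word in the Kashiwara operators (`true` stands for `ẽ`,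
`false` for `f̃`), leftmost entry applied first. -/
def applyWord (K : KacMoodyData I V) :
    List (I × Bool) → Option (ℝ → V) → Option (ℝ → V)
  | [], o => o
  | p :: rest, o =>
      applyWord K rest (o.bind fun f => if p.2 then K.eop p.1 f else K.fop p.1 f)

/-- `B(μ)^{*m}`: the set of `m`-fold concatenations of LS paths of shape `μ`. -/
def ConcatSet (μ : V) (m : ℕ) : Set (ℝ → V) :=
  {g | ∃ l : List (ℝ → V), l.length = m ∧ (∀ f ∈ l, f ∈ K.B μ) ∧ g = concatList l}

/-- `ε_i` of a tensor product (encoded as a list of paths, Kashiwara's rule):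
`ε_i(b₁ ⊗ b₂) = max (ε_i b₁) (ε_i b₂ - ⟨wt b₁, α_i∨⟩)`. -/
def tensEps (K : KacMoodyData I V) (i : I) : List (ℝ → V) → ℤ
  | [] => 0
  | [b] => (K.epsilon i b : ℤ)
  | b :: c :: rest =>
      max ((K.epsilon i b : ℤ)) (tensEps K i (c :: rest) - ⌊K.coroot i (b 1)⌋)

/-- `φ_i` of a tensor product (Kashiwara's rule):
`φ_i(b₁ ⊗ b₂) = max (φ_i b₂) (φ_i b₁ + ⟨wt b₂, α_i∨⟩)`. -/
def tensPhi (K : KacMoodyData I V) (i : I) : List (ℝ → V) → ℤ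
  | [] => 0
  | [b] => (K.phi i b : ℤ)
  | b :: c :: rest =>
      max (tensPhi K i (c :: rest)) ((K.phi i b : ℤ) + ⌊K.coroot i (tensWt (c :: rest))⌋)

/-- `ẽ_i` on a tensor product (Kashiwara's rule):
`ẽ_i(b₁ ⊗ b₂) = (ẽ_i b₁) ⊗ b₂` if `φ_i(b₁) ≥ ε_i(b₂)`, else `b₁ ⊗ (ẽ_i b₂)`. -/
def tensE (K : KacMoodyData I V) (i : I) : List (ℝ → V) → Option (List (ℝ → V))
  | [] => none
  | [b] => (K.eop i b).map fun b' => [b']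
  | b :: c :: rest =>
      if K.tensEps i (c :: rest) ≤ (K.phi i b : ℤ) then
        (K.eop i b).map fun b' => b' :: c :: rest
      else (tensE K i (c :: rest)).map fun r' => b :: r'

/-- `f̃_i` on a tensor product (Kashiwara's rule):
`f̃_i(b₁ ⊗ b₂) = (f̃_i b₁) ⊗ b₂` if `φ_i(b₁) > ε_i(b₂)`, else `b₁ ⊗ (f̃_i b₂)`. -/
def tensF (K : KacMoodyData I V) (i : I) : List (ℝ → V) → Option (List (ℝ → V))
  | [] => none
  | [b] => (K.fop i b).map fun b' => [b']
  | b :: c :: rest =>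
      if K.tensEps i (c :: rest) < (K.phi i b : ℤ) then
        (K.fop i b).map fun b' => b' :: c :: rest
      else (tensF K i (c :: rest)).map fun r' => b :: r'

/-- `ẽ_i^n` on tensor products. -/
def tensEIter (i : I) (n : ℕ) (l : List (ℝ → V)) : Option (List (ℝ → V)) :=
  (fun o => o.bind (K.tensE i))^[n] (some l)

/-- `f̃_i^n` on tensor products. -/
def tensFIter (i : I) (n : ℕ) (l : List (ℝ → V)) : Option (List (ℝ → V)) :=
  (fun o => o.bind (K.tensF i))^[n] (some l)

end KacMoodyData

end LSPaper

namespace LSPaper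

open KacMoodyData

section RealFunctions

/-- Let `b` be a step sequence and let each `H l` be a function which is V-shaped around `b l` with
slope `c l`.  If the breakpoints have integral position relative to `c`, then some `H l` attains
its minimum at `b l`, and exceeds it by at least one up to the time `b l - 1 / c l`. -/
lemma exists_first_min (c : ℤ → ℤ) (b : ℤ → ℝ) (H : ℤ → ℝ → ℝ) (N : ℕ)
    (hc : ∀ l, 0 < c l) (hrec : ∀ l, c l ∣ c (l - 1) + c (l + 1))
    (hb : Antitone b) (hb0 : b 0 = 1) (hb1 : b (-1) = 1) (hN : b N = 0)
    (hnn : ∀ l, 0 ≤ b l) (hint : ∀ l, ∃ n : ℤ, (c l : ℝ) * b l = n)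
    (hH0 : ∀ l, H l 0 = 0) (hper : ∀ l, H (l + 2) = H l)
    (hloc : ∀ l, ∀ t ∈ Set.Icc (b (l + 1)) (b (l - 1)),
      H l t = H l (b l) + c l * |t - b l|) :
    ∃ l : ℤ, 0 ≤ l ∧ l < N ∧ 1 ≤ c l * (b l - b (l + 1)) ∧
      (∀ t ∈ Set.Icc (0 : ℝ) 1, H l (b l) ≤ H l t) ∧
      ∀ t, 0 ≤ t → c l * (b l - t) ≥ 1 → H l (b l) + 1 ≤ H l t := by
  obtain ⟨L, hL, hLpos, hLN⟩ : ∃ L : ℕ, b (L + 1) = 0 ∧ 0 < b L ∧ L < N := by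
    have hex : ∃ n : ℕ, b n = 0 := ⟨N, hN⟩
    have h0 : Nat.find hex ≠ 0 := by
      intro h
      have := Nat.find_spec hex
      rw [h] at this
      simp [hb0] at this
    obtain ⟨L, hL⟩ := Nat.exists_eq_succ_of_ne_zero h0
    refine ⟨L, ?_, ?_, ?_⟩
    · have := Nat.find_spec hex
      rw [hL] at this
      exact_mod_cast this
    · have : ¬ b L = 0 := Nat.find_min hex (by omega)
      exact lt_of_le_of_ne (hnn _) (Ne.symm this)
    · have := Nat.find_min' hex hN
      omega
  have hperk : ∀ k : ℕ, H (L - 2 * k) = H L := by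
    intro k
    induction k with
    | zero => simp
    | succ k ih =>
      rw [← ih, ← hper (L - 2 * (k + 1 : ℕ))]
      congr 1
      push_cast
      ring
  set G : ℕ → ℝ := fun k => H L (b (L - 2 * k)) with hG
  have hlocG : ∀ k : ℕ, ∀ t ∈ Set.Icc (b (L - 2 * k + 1)) (b (L - 2 * k - 1)),
      H L t = G k + c (L - 2 * k) * |t - b (L - 2 * k)| := by
    intro k t ht
    have := hloc (L - 2 * k) t ht
    rwa [hperk k] at this
  have hcR : ∀ l, (0 : ℝ) < c l := fun l => by exact_mod_cast hc l
  have hGL : G 0 = - (c L * b L) := by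
    have := hlocG 0 0 ⟨by simp [hL], hnn _⟩
    rw [hH0] at this
    simp [abs_of_pos hLpos] at this
    linarith
  have hGint : ∀ k, ∃ z : ℤ, G k = z := by
    intro k
    induction k with
    | zero =>
      obtain ⟨n, hn⟩ := hint L
      exact ⟨-n, by rw [hGL, hn]; push_cast; ring⟩
    | succ k ih =>
      obtain ⟨z, hz⟩ := ih
      have e1 : (L : ℤ) - 2 * (k + 1 : ℕ) + 1 = L - 2 * k - 1 := by push_cast; ring
      have e2 : (L : ℤ) - 2 * (k + 1 : ℕ) = L - 2 * k - 1 - 1 := by push_cast; ring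
      have h1 := hlocG k (b (L - 2 * k - 1)) ⟨hb (by omega), le_rfl⟩
      have h2 := hlocG (k + 1) (b (L - 2 * k - 1)) ⟨by rw [e1], hb (by omega)⟩
      rw [h1, abs_of_nonneg (sub_nonneg.2 (hb (by omega))),
        abs_of_nonpos (sub_nonpos.2 (hb (by omega)))] at h2
      obtain ⟨n1, hn1⟩ := hint (L - 2 * k)
      obtain ⟨n2, hn2⟩ := hint (L - 2 * (k + 1 : ℕ))
      obtain ⟨n3, hn3⟩ := hint (L - 2 * k - 1)
      obtain ⟨q, hq⟩ := hrec (L - 2 * k - 1)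
      rw [← e2, show (L : ℤ) - 2 * k - 1 + 1 = L - 2 * k by ring] at hq
      have hq' : (c (L - 2 * (k + 1 : ℕ)) : ℝ) + c (L - 2 * k) = c (L - 2 * k - 1) * q := by
        exact_mod_cast hq
      refine ⟨z - n1 - n2 + q * n3, ?_⟩
      push_cast
      rw [← hn1, ← hn2, ← hn3, ← hz]
      have h5 : (c (L - 2 * (k + 1 : ℕ)) : ℝ) * b (L - 2 * k - 1) + c (L - 2 * k) * b (L - 2 * k - 1)
          = c (L - 2 * k - 1) * q * b (L - 2 * k - 1) := by
        rw [← hq']; ring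
      linarith
  have hcover : ∀ t ∈ Set.Icc (0 : ℝ) 1, ∃ k ≤ L / 2,
      t ∈ Set.Icc (b (L - 2 * k + 1)) (b (L - 2 * k - 1)) := by
    intro t ht
    have hend : t ≤ b (L - 2 * (L / 2 : ℕ) - 1) := by
      have : (1 : ℝ) ≤ b (L - 2 * (L / 2 : ℕ) - 1) := by
        rw [← hb0]
        exact hb (by omega)
      exact ht.2.trans this
    have hex : ∃ k : ℕ, t ≤ b (L - 2 * k - 1) := ⟨_, hend⟩
    refine ⟨Nat.find hex, Nat.find_min' hex hend, ?_, Nat.find_spec hex⟩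
    rcases Nat.eq_zero_or_pos (Nat.find hex) with h | h
    · rw [h]
      simpa [hL] using ht.1
    · have := Nat.find_min hex (m := Nat.find hex - 1) (by omega)
      push Not at this
      rw [show (L : ℤ) - 2 * (Nat.find hex : ℕ) + 1 = L - 2 * (Nat.find hex - 1 : ℕ) - 1 by omega]
      exact this.le
  have hmin : ∃ k : ℕ, k ≤ L / 2 ∧ ∀ k' ≤ L / 2, G k ≤ G k' := by
    obtain ⟨k, hk, h⟩ := Finset.exists_min_image (Finset.range (L / 2 + 1)) G ⟨0, by simp⟩
    exact ⟨k, by simpa [Nat.lt_succ_iff] using hk, fun k' hk' => h k' (by simpa [Nat.lt_succ_iff])⟩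
  obtain ⟨hk1, hk2⟩ := Nat.find_spec hmin
  have hk3 : ∀ k' < Nat.find hmin, G (Nat.find hmin) + 1 ≤ G k' := by
    intro k' hk'
    have h1 := Nat.find_min hmin hk'
    push Not at h1
    obtain ⟨k'', h2, h3⟩ := h1 (by omega)
    have h4 := (hk2 k'' h2).trans_lt h3
    obtain ⟨z, hz⟩ := hGint k'
    obtain ⟨w, hw⟩ := hGint (Nat.find hmin)
    rw [hz, hw] at h4 ⊢
    exact_mod_cast h4
  set k := Nat.find hmin with hk
  have hHb : H (L - 2 * k) (b (L - 2 * k)) = G k := by rw [hperk k]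
  refine ⟨L - 2 * k, by omega, by omega, ?_, ?_, ?_⟩
  · have h1 := hlocG k (b (L - 2 * k + 1)) ⟨le_rfl, hb (by omega)⟩
    rw [abs_of_nonpos (sub_nonpos.2 (hb (by omega)))] at h1
    rcases Nat.eq_zero_or_pos k with h | h
    · have hbL : (1 : ℝ) ≤ c L * b L := by
        obtain ⟨n, hn⟩ := hint L
        have : (0 : ℝ) < c L * b L := mul_pos (hcR _) hLpos
        rw [hn] at this ⊢
        exact_mod_cast this
      rw [h]
      simpa [hL] using hbL
    · have e1 : (L : ℤ) - 2 * k + 1 = L - 2 * (k - 1 : ℕ) - 1 := by omega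
      have h2 := hlocG (k - 1) (b (L - 2 * k + 1)) ⟨by rw [e1]; exact hb (by omega), by rw [e1]⟩
      have h3 := hk3 (k - 1) (by omega)
      have h4 : 0 ≤ (c (L - 2 * (k - 1 : ℕ)) : ℝ) * |b (L - 2 * k + 1) - b (L - 2 * (k - 1 : ℕ))| :=
        mul_nonneg (hcR _).le (abs_nonneg _)
      linarith
  · intro t ht
    obtain ⟨k', hk', hkt⟩ := hcover t ht
    rw [hHb, hperk, hlocG k' t hkt]
    have := hk2 k' hk'
    have h4 : 0 ≤ (c (L - 2 * k') : ℝ) * |t - b (L - 2 * k')| :=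
      mul_nonneg (hcR _).le (abs_nonneg _)
    linarith
  · intro t ht0 ht
    have htb : t < b (L - 2 * k) := by
      by_contra! h
      nlinarith [hcR (L - 2 * k)]
    have ht1 : t ≤ 1 := by
      refine htb.le.trans ?_
      rw [← hb1]
      exact hb (by omega)
    obtain ⟨k', hk', hkt⟩ := hcover t ⟨ht0, ht1⟩
    rw [hHb, hperk, hlocG k' t hkt]
    have h4 : 0 ≤ (c (L - 2 * k') : ℝ) * |t - b (L - 2 * k')| :=
      mul_nonneg (hcR _).le (abs_nonneg _)
    rcases lt_trichotomy k' k with h | h | h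
    · have := hk3 k' h
      linarith
    · subst h
      rw [abs_of_neg (sub_neg.2 htb)]
      linarith
    · have : b (L - 2 * k) ≤ b (L - 2 * k' + 1) := hb (by omega)
      linarith [hkt.1]

end RealFunctions

section RootOperators

variable {V : Type*} [AddCommGroup V] [Module ℝ V] {I : Type*} [Fintype I] [DecidableEq I]
variable (K : KacMoodyData I V)

lemma refl_apply (i : I) (x : V) : K.refl i x = x - K.coroot i x • K.α i := rfl

lemma coroot_self (i : I) : K.coroot i (K.α i) = 2 := by
  rw [K.cartanPairing, K.diag]
  norm_num

lemma mval_eq {i : I} {f : ℝ → V} {m t₀ : ℝ} (ht₀ : t₀ ∈ Set.Icc (0 : ℝ) 1)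
    (h₀ : K.H i f t₀ = m) (hmin : ∀ t ∈ Set.Icc (0 : ℝ) 1, m ≤ K.H i f t) : K.mval i f = m := by
  refine IsLeast.csInf_eq ⟨⟨t₀, ht₀, h₀⟩, ?_⟩
  rintro _ ⟨t, ht, rfl⟩
  exact hmin t ht

lemma fop_eq {i : I} {f g : ℝ → V} {m t₀ t₁ : ℝ} (h0 : 0 ≤ t₀) (h01 : t₀ < t₁) (h1 : t₁ ≤ 1)
    (hm : K.H i f t₀ = m) (hm₁ : K.H i f t₁ = m + 1)
    (hmin : ∀ t ∈ Set.Icc (0 : ℝ) 1, m ≤ K.H i f t)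
    (hlast : ∀ t, t₀ < t → t ≤ 1 → m < K.H i f t)
    (hfirst : ∀ t, t₀ ≤ t → t < t₁ → K.H i f t < m + 1)
    (hg₀ : ∀ t ≤ t₀, f t = g t)
    (hg₁ : ∀ t, t₀ < t → t ≤ t₁ → K.refl i (f t - f t₀) + f t₀ = g t)
    (hg₂ : ∀ t, t₁ < t → f t - K.α i = g t) : K.fop i f = some g := by
  have hmv : K.mval i f = m := mval_eq K ⟨h0, h01.le.trans h1⟩ hm hmin
  have e0 : sSup {t | t ∈ Set.Icc (0 : ℝ) 1 ∧ K.H i f t = m} = t₀ := by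
    refine IsGreatest.csSup_eq ⟨⟨⟨h0, h01.le.trans h1⟩, hm⟩, ?_⟩
    rintro t ⟨ht, htm⟩
    by_contra! h
    exact (hlast t h ht.2).ne' htm
  have e1 : sInf {t | t ∈ Set.Icc t₀ 1 ∧ K.H i f t = m + 1} = t₁ := by
    refine IsLeast.csInf_eq ⟨⟨⟨h01.le, h1⟩, hm₁⟩, ?_⟩
    rintro t ⟨ht, htm⟩
    by_contra! h
    exact (hfirst t ht.1 h).ne htm
  have hne : ¬ K.H i f 1 - K.mval i f = 0 := by
    rw [hmv]
    have := hlast 1 (h01.trans_le h1) le_rfl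
    linarith
  rw [fop, if_neg hne]
  congr 1
  funext t
  simp only [fraw, hmv, e0, e1]
  split_ifs with h h'
  · exact hg₀ t h
  · exact hg₁ t (not_le.1 h) h'
  · exact hg₂ t (not_le.1 h')

lemma eop_eq {i : I} {f g : ℝ → V} {m t₀ t₁ : ℝ} (h0 : 0 ≤ t₀) (h01 : t₀ < t₁) (h1 : t₁ ≤ 1)
    (hneg : m < 0) (hm : K.H i f t₁ = m) (hm₀ : K.H i f t₀ = m + 1)
    (hmin : ∀ t ∈ Set.Icc (0 : ℝ) 1, m ≤ K.H i f t)
    (hfirst : ∀ t, 0 ≤ t → t < t₁ → m < K.H i f t)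
    (hlast : ∀ t, t₀ < t → t ≤ t₁ → K.H i f t < m + 1)
    (hg₀ : ∀ t ≤ t₀, f t = g t)
    (hg₁ : ∀ t, t₀ < t → t ≤ t₁ → K.refl i (f t - f t₀) + f t₀ = g t)
    (hg₂ : ∀ t, t₁ < t → f t + K.α i = g t) : K.eop i f = some g := by
  have hmv : K.mval i f = m := mval_eq K ⟨h0.trans h01.le, h1⟩ hm hmin
  have e1 : sInf {t | t ∈ Set.Icc (0 : ℝ) 1 ∧ K.H i f t = m} = t₁ := by
    refine IsLeast.csInf_eq ⟨⟨⟨h0.trans h01.le, h1⟩, hm⟩, ?_⟩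
    rintro t ⟨ht, htm⟩
    by_contra! h
    exact (hfirst t ht.1 h).ne' htm
  have e0 : sSup {t | t ∈ Set.Icc (0 : ℝ) t₁ ∧ K.H i f t = m + 1} = t₀ := by
    refine IsGreatest.csSup_eq ⟨⟨⟨h0, h01.le⟩, hm₀⟩, ?_⟩
    rintro t ⟨ht, htm⟩
    by_contra! h
    exact (hlast t h ht.2).ne htm
  rw [eop, if_neg (by rw [hmv]; exact hneg.ne)]
  congr 1
  funext t
  simp only [eraw, hmv, e0, e1]
  split_ifs with h h'
  · exact hg₀ t h
  · exact hg₁ t (not_le.1 h) h'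
  · exact hg₂ t (not_le.1 h')

lemma applyWord_concat (w : List (I × Bool)) (p : I × Bool) (o : Option (ℝ → V)) :
    K.applyWord (w ++ [p]) o =
      (K.applyWord w o).bind fun f => if p.2 then K.eop p.1 f else K.fop p.1 f := by
  induction w generalizing o with
  | nil => rfl
  | cons q w ih => exact ih _

end RootOperators

lemma clamp01_of_mem {t : ℝ} (ht : t ∈ Set.Icc (0 : ℝ) 1) : clamp01 t = t := by
  rw [clamp01, min_eq_right ht.2, max_eq_right ht.1]

lemma clamp01_mem (t : ℝ) : clamp01 t ∈ Set.Icc (0 : ℝ) 1 :=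
  ⟨le_max_left _ _, max_le zero_le_one (min_le_left _ _)⟩

lemma clamp01_le {t v : ℝ} (hv : 0 ≤ v) (ht : t ≤ v) : clamp01 t ≤ v :=
  max_le hv ((min_le_right _ _).trans ht)

lemma le_clamp01 {t v : ℝ} (hv : v ≤ 1) (ht : v ≤ t) : v ≤ clamp01 t :=
  le_max_of_le_right (le_min hv ht)

/-- An enumeration `ν` of weights by `ℤ`, consecutive ones being related by simple reflections,
such that `ν (l + 1) = ν l - c l • α (ix l)` with positive pairings `c l`. -/
structure OrbitChain {V : Type*} [AddCommGroup V] [Module ℝ V] (K : KacMoodyData (Fin 2) V) where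
  ix : ℤ → Fin 2
  c : ℤ → ℤ
  ν : ℤ → V
  ix_add_two : ∀ l, ix (l + 2) = ix l
  c_pos : ∀ l, 0 < c l
  c_zero : c 0 = 1
  c_neg_one : c (-1) = 1
  c_dvd : ∀ l, c l ∣ c (l - 1) + c (l + 1)
  c_coprime : ∀ l, IsCoprime (c l) (c (l + 1))
  ν_succ : ∀ l, ν (l + 1) = ν l - (c l : ℝ) • K.α (ix l)
  pair : ∀ l, K.coroot (ix l) (ν l) = c l
  ix_ne : ∀ l, ix (l + 1) ≠ ix l

namespace OrbitChain

variable {V : Type*} [AddCommGroup V] [Module ℝ V] {K : KacMoodyData (Fin 2) V} (C : OrbitChain K)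

lemma cR_pos (l : ℤ) : (0 : ℝ) < C.c l := by exact_mod_cast C.c_pos l

lemma refl_ν (l : ℤ) : K.refl (C.ix l) (C.ν l) = C.ν (l + 1) := by
  rw [refl_apply, C.pair, C.ν_succ]

lemma pair_succ (l : ℤ) : K.coroot (C.ix l) (C.ν (l + 1)) = - C.c l := by
  rw [C.ν_succ, map_sub, map_smul, C.pair, coroot_self, smul_eq_mul]
  ring

lemma refl_ν_succ (l : ℤ) : K.refl (C.ix l) (C.ν (l + 1)) = C.ν l := by
  rw [refl_apply, C.pair_succ, C.ν_succ]
  module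

/-- The path `f` has direction `ν l` on the interval `[b l, b (l - 1)]`, for every `l`. -/
structure Follows (N : ℕ) (b : ℤ → ℝ) (f : ℝ → V) : Prop where
  anti : Antitone b
  int : ∀ l, ∃ n : ℤ, (C.c l : ℝ) * b l = n
  eq_zero : ∀ l, (N : ℤ) ≤ l → b l = 0
  eq_one : ∀ l, l < -(N : ℤ) → b l = 1
  map_zero : f 0 = 0
  map_clamp : ∀ t, f t = f (clamp01 t)
  seg : ∀ l, ∀ t ∈ Set.Icc (b l) (b (l - 1)), f t = f (b l) + (t - b l) • C.ν l

namespace Follows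

variable {C} {N : ℕ} {b : ℤ → ℝ} {f : ℝ → V}

lemma nonneg (h : C.Follows N b f) (l : ℤ) : 0 ≤ b l := by
  rw [← h.eq_zero (max N l) (le_max_left _ _)]
  exact h.anti (le_max_right _ _)

lemma le_one (h : C.Follows N b f) (l : ℤ) : b l ≤ 1 := by
  rw [← h.eq_one (min (-(N : ℤ) - 1) l) (lt_of_le_of_lt (min_le_left _ _) (by omega))]
  exact h.anti (min_le_right _ _)

lemma two_seg (h : C.Follows N b f) (l : ℤ) {t : ℝ} (ht : t ∈ Set.Icc (b (l + 1)) (b (l - 1))) :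
    f t = f (b (l + 1)) + (t - b (l + 1)) • C.ν (l + 1)
      + ((C.c l : ℝ) * (t - min t (b l))) • K.α (C.ix l) := by
  have key := h.seg (l + 1)
  rw [add_sub_cancel_right] at key
  rcases le_total t (b l) with hl | hl
  · rw [min_eq_left hl, key t ⟨ht.1, hl⟩]
    simp
  · rw [min_eq_right hl, h.seg l t ⟨hl, ht.2⟩, key (b l) ⟨h.anti (by omega), le_rfl⟩, C.ν_succ]
    module

lemma H_loc (h : C.Follows N b f) (l : ℤ) (t : ℝ) (ht : t ∈ Set.Icc (b (l + 1)) (b (l - 1))) :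
    K.H (C.ix l) f t = K.H (C.ix l) f (b l) + C.c l * |t - b l| := by
  have hb1 : b (l + 1) ≤ b l := h.anti (by omega)
  have hb2 : b l ≤ b (l - 1) := h.anti (by omega)
  simp only [KacMoodyData.H]
  rw [h.two_seg l ht, h.two_seg l ⟨hb1, hb2⟩]
  simp only [map_add, map_smul, C.pair_succ, coroot_self, smul_eq_mul, min_self, sub_self]
  rcases le_total t (b l) with hl | hl
  · rw [min_eq_left hl, abs_of_nonpos (by linarith)]
    ring
  · rw [min_eq_right hl, abs_of_nonneg (by linarith)]
    ring

/-- Moving the breakpoint `b l` to `v`. -/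
def move (C : OrbitChain K) (b : ℤ → ℝ) (f : ℝ → V) (l : ℤ) (v : ℝ) : ℝ → V := fun t =>
  f t + ((C.c l : ℝ) * (min (clamp01 t) (b l) - min (clamp01 t) v)) • K.α (C.ix l)

lemma H_move (l : ℤ) (v : ℝ) {t : ℝ} (ht : t ∈ Set.Icc (0 : ℝ) 1) :
    K.H (C.ix l) (move C b f l v) t =
      K.H (C.ix l) f t + 2 * C.c l * (min t (b l) - min t v) := by
  simp only [KacMoodyData.H, move, map_add, map_smul, coroot_self, smul_eq_mul, clamp01_of_mem ht]
  ring

lemma update (h : C.Follows N b f) {l : ℤ} {v : ℝ} (h1 : b (l + 1) ≤ v) (h2 : v ≤ b (l - 1))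
    (hv : ∃ n : ℤ, (C.c l : ℝ) * v = n) (hl1 : -(N : ℤ) ≤ l) (hl2 : l < N) :
    C.Follows N (Function.update b l v) (move C b f l v) := by
  have hv0 : 0 ≤ v := (h.nonneg _).trans h1
  have hv1 : v ≤ 1 := h2.trans (h.le_one _)
  have hbl1 : b (l + 1) ≤ b l := h.anti (by omega)
  have hbl2 : b l ≤ b (l - 1) := h.anti (by omega)
  have htwo : ∀ t ∈ Set.Icc (b (l + 1)) (b (l - 1)), move C b f l v t =
      f (b (l + 1)) + (t - b (l + 1)) • C.ν (l + 1)
      + ((C.c l : ℝ) * (t - min t v)) • K.α (C.ix l) := by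
    intro t ht
    rw [move, clamp01_of_mem ⟨(h.nonneg _).trans ht.1, ht.2.trans (h.le_one _)⟩, h.two_seg l ht]
    module
  refine ⟨?_, ?_, ?_, ?_, ?_, ?_, ?_⟩
  · intro x y hxy
    by_cases hx : x = l
    · subst hx
      by_cases hy : y = x
      · rw [hy]
      · rw [Function.update_self, Function.update_of_ne hy]
        exact (h.anti (by omega)).trans h1
    · by_cases hy : y = l
      · subst hy
        rw [Function.update_self, Function.update_of_ne hx]
        exact h2.trans (h.anti (by omega))
      · rw [Function.update_of_ne hx, Function.update_of_ne hy]
        exact h.anti hxy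
  · intro k
    by_cases hk : k = l
    · subst hk
      simpa using hv
    · rw [Function.update_of_ne hk]
      exact h.int k
  · intro k hk
    rw [Function.update_of_ne (by omega)]
    exact h.eq_zero k hk
  · intro k hk
    rw [Function.update_of_ne (by omega)]
    exact h.eq_one k hk
  · have : clamp01 0 = 0 := clamp01_of_mem ⟨le_rfl, zero_le_one⟩
    simp [move, this, h.map_zero, h.nonneg l, hv0]
  · intro t
    simp only [move]
    rw [h.map_clamp t, clamp01_of_mem (clamp01_mem t)]
  · intro k t ht
    by_cases hk : k = l
    · subst hk
      rw [Function.update_self, Function.update_of_ne (by omega)] at ht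
      rw [Function.update_self, htwo t ⟨h1.trans ht.1, ht.2⟩, htwo v ⟨h1, h2⟩, min_self,
        min_eq_right ht.1, C.ν_succ]
      module
    · rw [Function.update_of_ne hk] at ht ⊢
      by_cases hk' : k = l + 1
      · subst hk'
        rw [add_sub_cancel_right, Function.update_self] at ht
        rw [htwo t ⟨ht.1, ht.2.trans h2⟩, htwo (b (l + 1)) ⟨le_rfl, h.anti (by omega)⟩,
          min_eq_left ht.2, min_eq_left h1]
        module
      · rw [Function.update_of_ne (by omega)] at ht
        have hk0 := h.nonneg k
        have hk1 := h.le_one (k - 1)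
        rw [move, move, clamp01_of_mem ⟨hk0.trans ht.1, ht.2.trans hk1⟩,
          clamp01_of_mem ⟨hk0, h.le_one k⟩, h.seg k t ht]
        rcases lt_or_gt_of_ne hk with hlt | hgt
        · have hkl : b (l - 1) ≤ b k := h.anti (by omega)
          rw [min_eq_right (a := t), min_eq_right (a := t), min_eq_right, min_eq_right]
          · module
          all_goals linarith [ht.1]
        · have hkl : b (k - 1) ≤ b (l + 1) := h.anti (by omega)
          rw [min_eq_left (a := t), min_eq_left (a := t), min_eq_left, min_eq_left]
          · module
          all_goals linarith [ht.1, ht.2]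

lemma sum_update (s : Finset ℤ) {l : ℤ} (hl : l ∈ s) (v : ℝ) :
    ∑ k ∈ s, (C.c k : ℝ) * Function.update b l v k =
      ∑ k ∈ s, (C.c k : ℝ) * b k + C.c l * (v - b l) := by
  have : ∑ k ∈ s, ((C.c k : ℝ) * Function.update b l v k - C.c k * b k) = C.c l * (v - b l) := by
    rw [Finset.sum_eq_single_of_mem l hl]
    · rw [Function.update_self]
      ring
    · intro k _ hk
      rw [Function.update_of_ne hk, sub_self]
  rw [Finset.sum_sub_distrib] at this
  linarith

lemma H_zero (h : C.Follows N b f) (i : Fin 2) : K.H i f 0 = 0 := by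
  simp [KacMoodyData.H, h.map_zero]

lemma exists_fop (h : C.Follows N b f) (h0 : b 0 = 1) (h1 : b (-1) = 1) :
    ∃ (l : ℤ) (v : ℝ), 0 ≤ l ∧ l < N ∧ (C.c l : ℝ) * (v - b l) = -1 ∧
      C.Follows N (Function.update b l v) (move C b f l v) ∧
      K.fop (C.ix l) (move C b f l v) = some f := by
  obtain ⟨l, hl0, hlN, hlen, hmin, hmin'⟩ := exists_first_min C.c b (fun l => K.H (C.ix l) f) N
    C.c_pos C.c_dvd h.anti h0 h1 (h.eq_zero _ le_rfl) h.nonneg h.int (fun l => h.H_zero _)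
    (fun l => by rw [C.ix_add_two]) h.H_loc
  have hc := C.cR_pos l
  obtain ⟨v, hv⟩ : ∃ v, (C.c l : ℝ) * (b l - v) = 1 := ⟨b l - 1 / C.c l, by field_simp; ring⟩
  have hvb : v < b l := by
    by_contra! h
    nlinarith
  have hbv : b (l + 1) ≤ v := by
    by_contra! h
    nlinarith
  have hv0 : 0 ≤ v := (h.nonneg _).trans hbv
  have hb1 : b l ≤ 1 := h.le_one l
  have hbb : b l ≤ b (l - 1) := h.anti (by omega)
  have hint : ∃ n : ℤ, (C.c l : ℝ) * v = n := by
    obtain ⟨n, hn⟩ := h.int l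
    exact ⟨n - 1, by push_cast; linarith⟩
  have hmid : ∀ t ∈ Set.Icc v (b l), K.H (C.ix l) (move C b f l v) t =
      K.H (C.ix l) f (b l) + 1 + C.c l * (t - v) := by
    intro t ht
    rw [H_move l v ⟨hv0.trans ht.1, ht.2.trans hb1⟩, min_eq_left ht.2, min_eq_right ht.1,
      h.H_loc l t ⟨hbv.trans ht.1, ht.2.trans hbb⟩, abs_of_nonpos (sub_nonpos.2 ht.2)]
    linarith
  have hright : ∀ t, b l ≤ t → t ≤ 1 →
      K.H (C.ix l) f (b l) + 2 ≤ K.H (C.ix l) (move C b f l v) t := by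
    intro t ht ht1
    have ht0 := (hv0.trans hvb.le).trans ht
    rw [H_move l v ⟨ht0, ht1⟩, min_eq_right ht, min_eq_right (hvb.le.trans ht)]
    have := hmin t ⟨ht0, ht1⟩
    linarith
  refine ⟨l, v, hl0, hlN, by linarith, h.update hbv (hvb.le.trans hbb) hint (by omega) hlN, ?_⟩
  refine fop_eq K (m := K.H (C.ix l) f (b l) + 1) hv0 hvb hb1 ?_ ?_ ?_ ?_ ?_ ?_ ?_ ?_
  · rw [hmid v ⟨le_rfl, hvb.le⟩]
    ring
  · rw [hmid (b l) ⟨hvb.le, le_rfl⟩, hv]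
  · intro t ht
    rcases le_total t v with htv | htv
    · rw [H_move l v ht, min_eq_left htv, min_eq_left (htv.trans hvb.le)]
      have := hmin' t ht.1 (by nlinarith)
      linarith
    · rcases le_total t (b l) with htb | htb
      · rw [hmid t ⟨htv, htb⟩]
        nlinarith
      · linarith [hright t htb ht.2]
  · intro t htv ht1
    rcases le_total t (b l) with htb | htb
    · rw [hmid t ⟨htv.le, htb⟩]
      nlinarith
    · linarith [hright t htb ht1]
  · intro t htv htb
    rw [hmid t ⟨htv, htb.le⟩]
    nlinarith
  · intro t ht
    have hct := clamp01_le hv0 ht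
    simp [move, min_eq_left hct, min_eq_left (hct.trans hvb.le)]
  · intro t htv htb
    have e : ∀ s ∈ Set.Icc v (b l), f s =
        f (b (l + 1)) + (s - b (l + 1)) • C.ν (l + 1) := by
      intro s hs
      rw [h.two_seg l ⟨hbv.trans hs.1, hs.2.trans hbb⟩, min_eq_left hs.2]
      simp
    rw [move, move, clamp01_of_mem ⟨hv0.trans htv.le, htb.trans hb1⟩,
      clamp01_of_mem ⟨hv0, hvb.le.trans hb1⟩, min_eq_left htb, min_eq_right htv.le,
      min_eq_left hvb.le, min_self, e t ⟨htv.le, htb⟩, e v ⟨le_rfl, hvb.le⟩]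
    rw [show ∀ x : V, x + (t - b (l + 1)) • C.ν (l + 1) + ((C.c l : ℝ) * (t - v)) • K.α (C.ix l) -
        (x + (v - b (l + 1)) • C.ν (l + 1) + ((C.c l : ℝ) * (v - v)) • K.α (C.ix l)) =
        (t - v) • C.ν l by intro x; rw [C.ν_succ]; module, map_smul, C.refl_ν]
    module
  · intro t ht
    have hct := le_clamp01 hb1 ht.le
    simp [move, min_eq_right hct, min_eq_right (hvb.le.trans hct), hv]

lemma exists_eop (h : C.Follows N b f) (h0 : b 0 = 0) (h1 : b (-1) = 0) :
    ∃ (l : ℤ) (v : ℝ), -(N : ℤ) ≤ l ∧ l < 0 ∧ (C.c l : ℝ) * (v - b l) = 1 ∧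
      C.Follows N (Function.update b l v) (move C b f l v) ∧
      K.eop (C.ix l) (move C b f l v) = some f := by
  obtain ⟨l', hl0, hlN, hlen, hmin, hmin'⟩ := exists_first_min (fun l => C.c (-1 - l))
    (fun l => 1 - b (-1 - l))
    (fun l t => K.H (C.ix (-1 - l)) f (1 - t) - K.H (C.ix (-1 - l)) f 1) N
    (fun l => C.c_pos _)
    (fun l => by
      have := C.c_dvd (-1 - l)
      rwa [add_comm, show -1 - l + 1 = -1 - (l - 1) by ring,
        show -1 - l - 1 = -1 - (l + 1) by ring] at this)
    (fun x y hxy => sub_le_sub_left (h.anti (by omega)) _) (by simp [h1]) (by simp [h0])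
    (by rw [h.eq_one _ (by omega), sub_self])
    (fun l => sub_nonneg.2 (h.le_one _))
    (fun l => by
      obtain ⟨n, hn⟩ := h.int (-1 - l)
      exact ⟨C.c (-1 - l) - n, by push_cast; linarith⟩)
    (fun l => by simp)
    (fun l => by
      rw [← C.ix_add_two (-1 - (l + 2)), show -1 - (l + 2) + 2 = -1 - l by ring])
    (fun l t ht => by
      have := h.H_loc (-1 - l) (1 - t)
        ⟨by rw [show -1 - l + 1 = -1 - (l - 1) by ring]; linarith [ht.2],
          by rw [show -1 - l - 1 = -1 - (l + 1) by ring]; linarith [ht.1]⟩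
      rw [this, ← abs_neg]
      simp only [sub_sub_cancel]
      ring_nf)
  obtain ⟨l, rfl⟩ : ∃ l, l' = -1 - l := ⟨-1 - l', by ring⟩
  simp only [sub_sub_cancel, show -1 - (-1 - l + 1) = l - 1 by ring] at hlen hmin hmin'
  have hc := C.cR_pos l
  replace hmin : ∀ t ∈ Set.Icc (0 : ℝ) 1, K.H (C.ix l) f (b l) ≤ K.H (C.ix l) f t := by
    intro t ht
    have := hmin (1 - t) ⟨by linarith [ht.2], by linarith [ht.1]⟩
    rw [sub_sub_cancel] at this
    linarith
  replace hmin' : ∀ t ≤ (1 : ℝ), 1 ≤ C.c l * (t - b l) →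
      K.H (C.ix l) f (b l) + 1 ≤ K.H (C.ix l) f t := by
    intro t ht ht'
    have := hmin' (1 - t) (by linarith) (by linarith)
    rw [sub_sub_cancel] at this
    linarith
  obtain ⟨v, hv⟩ : ∃ v, (C.c l : ℝ) * (v - b l) = 1 := ⟨b l + 1 / C.c l, by field_simp; ring⟩
  have hvb : b l < v := by
    by_contra! h
    nlinarith
  have hbv : v ≤ b (l - 1) := by
    by_contra! h
    nlinarith
  have hv1 : v ≤ 1 := hbv.trans (h.le_one _)
  have hb0 : 0 ≤ b l := h.nonneg l
  have hbb : b (l + 1) ≤ b l := h.anti (by omega)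
  have hint : ∃ n : ℤ, (C.c l : ℝ) * v = n := by
    obtain ⟨n, hn⟩ := h.int l
    exact ⟨n + 1, by push_cast; linarith⟩
  have hmid : ∀ t ∈ Set.Icc (b l) v, K.H (C.ix l) (move C b f l v) t =
      K.H (C.ix l) f (b l) - C.c l * (t - b l) := by
    intro t ht
    rw [H_move l v ⟨hb0.trans ht.1, ht.2.trans hv1⟩, min_eq_right ht.1, min_eq_left ht.2,
      h.H_loc l t ⟨hbb.trans ht.1, ht.2.trans hbv⟩, abs_of_nonneg (sub_nonneg.2 ht.1)]
    ring
  have hleft : ∀ t, 0 ≤ t → t ≤ b l →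
      K.H (C.ix l) f (b l) ≤ K.H (C.ix l) (move C b f l v) t := by
    intro t ht0 ht
    have ht1 := (ht.trans hvb.le).trans hv1
    rw [H_move l v ⟨ht0, ht1⟩, min_eq_left ht, min_eq_left (ht.trans hvb.le)]
    linarith [hmin t ⟨ht0, ht1⟩]
  refine ⟨l, v, by omega, by omega, hv, h.update (hbb.trans hvb.le) hbv hint (by omega) (by omega),
    ?_⟩
  refine eop_eq K (m := K.H (C.ix l) f (b l) - 1) hb0 hvb hv1 ?_ ?_ ?_ ?_ ?_ ?_ ?_ ?_ ?_
  · have := hmin 0 ⟨le_rfl, zero_le_one⟩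
    rw [h.H_zero] at this
    linarith
  · rw [hmid v ⟨hvb.le, le_rfl⟩, hv]
  · rw [hmid (b l) ⟨le_rfl, hvb.le⟩]
    ring
  · intro t ht
    rcases le_total t (b l) with htb | htb
    · linarith [hleft t ht.1 htb]
    · rcases le_total t v with htv | htv
      · rw [hmid t ⟨htb, htv⟩]
        nlinarith
      · rw [H_move l v ht, min_eq_right htb, min_eq_right htv]
        have := hmin' t ht.2 (by nlinarith)
        linarith
  · intro t ht0 htv
    rcases le_total t (b l) with htb | htb
    · linarith [hleft t ht0 htb]
    · rw [hmid t ⟨htb, htv.le⟩]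
      nlinarith
  · intro t htb htv
    rw [hmid t ⟨htb.le, htv⟩]
    nlinarith
  · intro t ht
    have hct := clamp01_le hb0 ht
    simp [move, min_eq_left hct, min_eq_left (hct.trans hvb.le)]
  · intro t htb htv
    have e : f t = f (b l) + (t - b l) • C.ν l := h.seg l t ⟨htb.le, htv.trans hbv⟩
    rw [move, move, clamp01_of_mem ⟨hb0.trans htb.le, htv.trans hv1⟩,
      clamp01_of_mem ⟨hb0, hvb.le.trans hv1⟩, min_eq_right htb.le, min_eq_left htv,
      min_eq_left hvb.le, min_self, e]
    rw [show f (b l) + (t - b l) • C.ν l + ((C.c l : ℝ) * (b l - t)) • K.α (C.ix l) -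
        (f (b l) + ((C.c l : ℝ) * (b l - b l)) • K.α (C.ix l)) =
        (t - b l) • C.ν (l + 1) by rw [C.ν_succ]; module, map_smul, C.refl_ν_succ]
    module
  · intro t ht
    have hct := le_clamp01 hv1 ht.le
    have hv' : (C.c l : ℝ) * (b l - v) = -1 := by linarith
    simp [move, min_eq_right hct, min_eq_right (hvb.le.trans hct), hv']

lemma eq_straight (h : C.Follows N b f) (h0 : b 0 = 0) (h1 : b (-1) = 1) :
    f = straight (C.ν 0) := by
  funext t
  have hc := clamp01_mem t
  rw [h.map_clamp, h.seg 0 (clamp01 t) (by simpa [h0, h1] using hc), h0, h.map_zero]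
  simp [straight]

lemma breakpoint_eq (h : C.Follows N b f) {l : ℤ} (hl : C.c l = 1) : b l = 0 ∨ b l = 1 := by
  obtain ⟨n, hn⟩ := h.int l
  rw [hl, Int.cast_one, one_mul] at hn
  have h0 := h.nonneg l
  have h1 := h.le_one l
  rw [hn] at h0 h1 ⊢
  have h0' : 0 ≤ n := by exact_mod_cast h0
  have h1' : n ≤ 1 := by exact_mod_cast h1
  interval_cases n <;> simp

lemma exists_word_of_pos (m : ℕ) : ∀ {b : ℤ → ℝ} {f : ℝ → V}, C.Follows N b f → b (-1) = 1 →
    ∑ k ∈ Finset.Ico 0 (N : ℤ), (C.c k : ℝ) * b k ≤ m →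
    ∃ w, K.applyWord w (some (straight (C.ν 0))) = some f := by
  induction m with
  | zero =>
    intro b f h h1 hsum
    refine ⟨[], ?_⟩
    rcases h.breakpoint_eq C.c_zero with h0 | h0
    · rw [h.eq_straight h0 h1]
      rfl
    · exfalso
      have hN : (0 : ℤ) < N := by
        by_contra! hN
        rw [h.eq_zero 0 hN] at h0
        exact zero_ne_one h0
      have := Finset.single_le_sum (f := fun k => (C.c k : ℝ) * b k)
        (fun k _ => mul_nonneg (C.cR_pos k).le (h.nonneg k)) (Finset.mem_Ico.2 ⟨le_rfl, hN⟩)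
      simp only [C.c_zero, h0] at this
      norm_num at this hsum
      linarith
  | succ m ih =>
    intro b f h h1 hsum
    rcases h.breakpoint_eq C.c_zero with h0 | h0
    · exact ⟨[], by rw [h.eq_straight h0 h1]; rfl⟩
    · obtain ⟨l, v, hl0, hlN, hv, hF, hop⟩ := h.exists_fop h0 h1
      obtain ⟨w, hw⟩ := ih hF (by rw [Function.update_of_ne (by omega)]; exact h1) (by
        rw [sum_update _ (Finset.mem_Ico.2 ⟨hl0, hlN⟩), hv]
        push_cast at hsum
        linarith)
      exact ⟨w ++ [(C.ix l, false)], by rw [applyWord_concat, hw]; simpa using hop⟩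

lemma exists_word_of_neg (m : ℕ) : ∀ {b : ℤ → ℝ} {f : ℝ → V}, C.Follows N b f → b 0 = 0 →
    ∑ k ∈ Finset.Ico (-(N : ℤ)) 0, (C.c k : ℝ) ≤
      ∑ k ∈ Finset.Ico (-(N : ℤ)) 0, (C.c k : ℝ) * b k + m →
    ∃ w, K.applyWord w (some (straight (C.ν 0))) = some f := by
  induction m with
  | zero =>
    intro b f h h0 hsum
    refine ⟨[], ?_⟩
    rcases h.breakpoint_eq C.c_neg_one with h1 | h1
    · exfalso
      have hN : -(N : ℤ) ≤ -1 := by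
        by_contra! hN
        rw [h.eq_one (-1) hN] at h1
        exact one_ne_zero h1
      have := Finset.single_le_sum (f := fun k => (C.c k : ℝ) * (1 - b k))
        (fun k _ => mul_nonneg (C.cR_pos k).le (sub_nonneg.2 (h.le_one k)))
        (Finset.mem_Ico.2 ⟨hN, by norm_num⟩ : (-1 : ℤ) ∈ Finset.Ico (-(N : ℤ)) 0)
      simp only [C.c_neg_one, h1, mul_sub, Finset.sum_sub_distrib, mul_one] at this
      norm_num at this hsum
      linarith
    · rw [h.eq_straight h0 h1]
      rfl
  | succ m ih =>
    intro b f h h0 hsum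
    rcases h.breakpoint_eq C.c_neg_one with h1 | h1
    · obtain ⟨l, v, hl0, hlN, hv, hF, hop⟩ := h.exists_eop h0 h1
      obtain ⟨w, hw⟩ := ih hF (by rw [Function.update_of_ne (by omega)]; exact h0) (by
        rw [sum_update _ (Finset.mem_Ico.2 ⟨hl0, hlN⟩), hv]
        push_cast at hsum
        linarith)
      exact ⟨w ++ [(C.ix l, true)], by rw [applyWord_concat, hw]; simpa using hop⟩
    · exact ⟨[], by rw [h.eq_straight h0 h1]; rfl⟩

lemma exists_word (h : C.Follows N b f) :
    ∃ w, K.applyWord w (some (straight (C.ν 0))) = some f := by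
  rcases h.breakpoint_eq C.c_neg_one with h1 | h1
  · have h0 : b 0 = 0 := le_antisymm (h1 ▸ h.anti (by norm_num)) (h.nonneg 0)
    obtain ⟨m, hm⟩ := exists_nat_ge (∑ k ∈ Finset.Ico (-(N : ℤ)) 0, (C.c k : ℝ) -
      ∑ k ∈ Finset.Ico (-(N : ℤ)) 0, (C.c k : ℝ) * b k)
    exact exists_word_of_neg m h h0 (by linarith)
  · obtain ⟨m, hm⟩ := exists_nat_ge (∑ k ∈ Finset.Ico 0 (N : ℤ), (C.c k : ℝ) * b k)
    exact exists_word_of_pos m h h1 hm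

end Follows

section Orbit

lemma exists_refl_ν (j : Fin 2) (l : ℤ) : ∃ l', K.refl j (C.ν l) = C.ν l' := by
  by_cases h : C.ix l = j
  · exact ⟨l + 1, by rw [← h, C.refl_ν]⟩
  · have h1 := C.ix_ne (l - 1)
    rw [sub_add_cancel] at h1
    have h2 : C.ix (l - 1) = j := by
      have : ∀ x y z : Fin 2, x ≠ y → y ≠ z → z = x := by decide
      exact (this _ _ _ (fun e => h e.symm) h1)
    refine ⟨l - 1, ?_⟩
    have := C.refl_ν_succ (l - 1)
    rwa [sub_add_cancel, h2] at this

lemma exists_weyl_ν {w : V ≃ₗ[ℝ] V} (hw : w ∈ K.weylGroup) (l : ℤ) :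
    ∃ l', w (C.ν l) = C.ν l' := by
  suffices h : (∀ l, ∃ l', w (C.ν l) = C.ν l') ∧ ∀ l, ∃ l', w⁻¹ (C.ν l) = C.ν l' from h.1 l
  clear l
  induction hw using Subgroup.closure_induction with
  | mem x hx =>
    obtain ⟨j, rfl⟩ := hx
    exact ⟨C.exists_refl_ν j, C.exists_refl_ν j⟩
  | one => exact ⟨fun l => ⟨l, rfl⟩, fun l => ⟨l, by rw [inv_one]; rfl⟩⟩
  | mul x y _ _ hx hy =>
    refine ⟨fun l => ?_, fun l => ?_⟩
    · obtain ⟨l₁, h₁⟩ := hy.1 l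
      obtain ⟨l₂, h₂⟩ := hx.1 l₁
      exact ⟨l₂, by rw [LinearEquiv.mul_apply, h₁, h₂]⟩
    · obtain ⟨l₁, h₁⟩ := hx.2 l
      obtain ⟨l₂, h₂⟩ := hy.2 l₁
      exact ⟨l₂, by rw [mul_inv_rev, LinearEquiv.mul_apply, h₁, h₂]⟩
  | inv x _ hx => exact ⟨hx.2, by rw [inv_inv]; exact hx.1⟩

lemma height_ν_succ {φ : V →ₗ[ℝ] ℝ} (hφ : ∀ i, φ (K.α i) = 1)
    (l : ℤ) : φ (C.ν (l + 1)) = φ (C.ν l) - C.c l := by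
  rw [C.ν_succ, map_sub, map_smul, hφ, smul_eq_mul, mul_one]

lemma height_strictAnti {φ : V →ₗ[ℝ] ℝ} (hφ : ∀ i, φ (K.α i) = 1) :
    StrictAnti fun l => φ (C.ν l) := by
  refine strictAnti_int_of_succ_lt fun l => ?_
  rw [C.height_ν_succ hφ]
  linarith [C.cR_pos l]

lemma height_root {φ : V →ₗ[ℝ] ℝ} (hφ : ∀ i, φ (K.α i) = 1)
    {w : V ≃ₗ[ℝ] V} {i : Fin 2} (h : w (K.α i) ∈ K.Qplus) :
    ∃ n : ℕ, 0 < n ∧ φ (w (K.α i)) = n := by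
  obtain ⟨d, hd⟩ := h
  refine ⟨d 0 + d 1, ?_, ?_⟩
  · by_contra hn
    have h0 : d 0 = 0 := by omega
    have h1 : d 1 = 0 := by omega
    rw [Fin.sum_univ_two, h0, h1] at hd
    simp only [CharP.cast_eq_zero, zero_smul, add_zero, LinearEquiv.map_eq_zero_iff] at hd
    have := hφ i
    rw [hd, map_zero] at this
    exact zero_ne_one this
  · rw [hd, Fin.sum_univ_two]
    simp [hφ]

lemma conj_refl_apply (w : V ≃ₗ[ℝ] V) (i : Fin 2) (x : V) :
    w (K.refl i (w.symm x)) = x - K.coroot i (w.symm x) • w (K.α i) := by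
  rw [refl_apply, map_sub, map_smul, LinearEquiv.apply_symm_apply]

lemma stepDown_ν {φ : V →ₗ[ℝ] ℝ} (hφ : ∀ i, φ (K.α i) = 1)
    {m : ℤ} {x : V} (h : K.StepDown (C.ν m) x) : ∃ n < m, x = C.ν n := by
  obtain ⟨w, hw, i, hQ, hneg, rfl⟩ := h
  have hmem : w * K.refl i * w⁻¹ ∈ K.weylGroup :=
    mul_mem (mul_mem hw (Subgroup.subset_closure ⟨i, rfl⟩)) (inv_mem hw)
  obtain ⟨n, hn⟩ := C.exists_weyl_ν hmem m
  have hn' : w (K.refl i (w.symm (C.ν m))) = C.ν n := hn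
  refine ⟨n, ?_, hn'⟩
  rw [← (C.height_strictAnti hφ).lt_iff_gt]
  rw [← hn', conj_refl_apply, map_sub, map_smul, smul_eq_mul]
  obtain ⟨d, hd, hd'⟩ := height_root hφ hQ
  rw [hd']
  have : (0 : ℝ) < d := by exact_mod_cast hd
  nlinarith

lemma stepDown_pred (l : ℤ) : K.StepDown (C.ν (l + 1)) (C.ν l) := by
  refine ⟨1, one_mem _, C.ix l, ⟨Pi.single (C.ix l) 1, ?_⟩, ?_, ?_⟩
  · rw [Finset.sum_eq_single_of_mem (C.ix l) (Finset.mem_univ _)]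
    · simp
    · intro j _ hj
      simp [Pi.single_eq_of_ne hj]
  · change K.coroot (C.ix l) (C.ν (l + 1)) < 0
    rw [C.pair_succ]
    linarith [C.cR_pos l]
  · exact (C.refl_ν_succ l).symm

lemma chainLen_ν (m : ℤ) (k : ℕ) : K.chainLen k (C.ν m) (C.ν (m - k)) := by
  refine ⟨fun q => C.ν (m - q), by simp, rfl, fun q _ => ?_⟩
  have := C.stepDown_pred (m - (q + 1 : ℕ))
  rwa [show m - (q + 1 : ℕ) + 1 = m - q by push_cast; ring] at this

lemma eq_pred_of_dist {m n : ℤ} (hnm : n < m) (h : K.dist (C.ν m) (C.ν n) = 1) : n = m - 1 := by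
  obtain ⟨k, rfl⟩ : ∃ k : ℕ, n = m - k := ⟨(m - n).toNat, by omega⟩
  have hbdd : BddAbove {p | K.chainLen p (C.ν m) (C.ν (m - k))} := by
    by_contra hb
    rw [KacMoodyData.dist, Nat.sSup_of_not_bddAbove hb] at h
    exact zero_ne_one h
  have : k ≤ K.dist (C.ν m) (C.ν (m - k)) := le_csSup hbdd (C.chainLen_ν m k)
  omega

lemma sigma_step {φ : V →ₗ[ℝ] ℝ} (hφ : ∀ i, φ (K.α i) = 1)
    {m : ℤ} {σ : ℚ} {x : V} (hσ : 0 < σ) (hd : K.dist (C.ν m) x = 1)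
    (h : ∃ w ∈ K.weylGroup, ∃ i : Fin 2, w (K.α i) ∈ K.Qplus ∧
      x = w (K.refl i (w.symm (C.ν m))) ∧
      ∃ n : ℤ, n < 0 ∧ (σ : ℝ) * K.coroot i (w.symm (C.ν m)) = (n : ℝ)) :
    x = C.ν (m - 1) ∧ ∃ z : ℤ, (C.c (m - 1) : ℝ) * σ = z := by
  obtain ⟨w, hw, i, hQ, hx, n, hn, hσn⟩ := h
  have hσ' : (0 : ℝ) < σ := by exact_mod_cast hσ
  have hneg : K.coroot i (w.symm (C.ν m)) < 0 := by
    have : (n : ℝ) < 0 := by exact_mod_cast hn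
    by_contra! hc
    nlinarith [mul_nonneg hσ'.le hc]
  obtain ⟨k, hk, rfl⟩ := C.stepDown_ν hφ ⟨w, hw, i, hQ, hneg, hx⟩
  obtain rfl := C.eq_pred_of_dist hk hd
  refine ⟨rfl, ?_⟩
  obtain ⟨d, -, hd'⟩ := height_root hφ hQ
  have h1 := C.height_ν_succ hφ (m - 1)
  rw [sub_add_cancel, hx, conj_refl_apply, map_sub, map_smul, smul_eq_mul, hd'] at h1
  refine ⟨-n * d, ?_⟩
  push_cast
  rw [← hσn]
  linear_combination (σ : ℝ) * h1

lemma sigmaChain_ν {φ : V →ₗ[ℝ] ℝ} (hφ : ∀ i, φ (K.α i) = 1)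
    {m : ℤ} {σ : ℚ} {x : V} (h0 : 0 < σ) (h1 : σ < 1)
    (h : K.SigmaChain σ (C.ν m) x) :
    x = C.ν (m - 1) ∧ ∃ z : ℤ, (C.c (m - 1) : ℝ) * σ = z := by
  obtain ⟨p, hp, ξ, hξ0, hξp, hξ⟩ := h
  have hs0 := hξ 0 hp
  rw [hξ0] at hs0
  obtain ⟨e1, z1, hz1⟩ := C.sigma_step hφ h0 hs0.1 hs0.2
  rcases Nat.lt_or_ge 1 p with hp1 | hp1
  · exfalso
    have hs1 := hξ 1 hp1
    rw [zero_add] at e1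
    rw [e1] at hs1
    obtain ⟨-, z2, hz2⟩ := C.sigma_step hφ h0 hs1.1 hs1.2
    obtain ⟨u, v, huv⟩ := C.c_coprime (m - 1 - 1)
    rw [sub_add_cancel] at huv
    have huv' : (u : ℝ) * C.c (m - 1 - 1) + v * C.c (m - 1) = 1 := by exact_mod_cast huv
    have hσ : (σ : ℝ) = (u * z2 + v * z1 : ℤ) := by
      push_cast
      rw [← hz1, ← hz2]
      linear_combination (-(σ : ℝ)) * huv'
    have hσ' : σ = (u * z2 + v * z1 : ℤ) := by exact_mod_cast hσ
    rw [hσ'] at h0 h1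
    have h0' : 0 < u * z2 + v * z1 := by exact_mod_cast h0
    have h1' : u * z2 + v * z1 < 1 := by exact_mod_cast h1
    omega
  · obtain rfl : p = 1 := by omega
    exact ⟨hξp ▸ e1, z1, hz1⟩

lemma path_seg {μ : V} (π : K.LSData μ) (k : Fin π.s) {t : ℝ}
    (ht : t ∈ Set.Icc ((π.τ k.castSucc : ℚ) : ℝ) ((π.τ k.succ : ℚ) : ℝ)) :
    π.path t = π.path (π.τ k.castSucc : ℚ) + (t - (π.τ k.castSucc : ℚ)) • π.ν k := by
  have hmono : Monotone fun i => ((π.τ i : ℚ) : ℝ) := fun i j hij =>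
    Rat.cast_le.2 (π.τ_mono.monotone hij)
  have h1 := hmono (Fin.castSucc_lt_succ (i := k)).le
  rw [← sub_eq_iff_eq_add', LSData.path, LSData.path, ← Finset.sum_sub_distrib,
    Finset.sum_eq_single_of_mem k (Finset.mem_univ _)]
  · rw [min_eq_left ht.2, min_eq_right ht.1, min_eq_left h1, min_self]
    module
  · intro j _ hj
    have h2 := hmono (Fin.castSucc_lt_succ (i := j)).le
    simp only at h1 h2
    rcases lt_or_gt_of_ne hj with hlt | hgt
    · have h3 := hmono (show j.succ ≤ k.castSucc from Fin.le_def.2 (by simp; omega))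
      simp only at h3
      rw [min_eq_right, min_eq_right, min_eq_right, min_eq_right, sub_self]
      all_goals linarith [ht.1]
    · have h3 := hmono (show k.succ ≤ j.castSucc from Fin.le_def.2 (by simp; omega))
      simp only at h3
      rw [min_eq_left, min_eq_left, min_eq_left, min_eq_left]
      · simp
      all_goals linarith [ht.2]

lemma path_clamp {μ : V} (π : K.LSData μ) (t : ℝ) : π.path t = π.path (clamp01 t) := by
  have h0 : ∀ i, (0 : ℝ) ≤ (π.τ i : ℚ) := fun i => by
    have := π.τ_mono.monotone (Fin.zero_le i)
    rw [π.τ_zero] at this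
    exact_mod_cast this
  have h1 : ∀ i, ((π.τ i : ℚ) : ℝ) ≤ 1 := fun i => by
    have := π.τ_mono.monotone (Fin.le_last i)
    rw [π.τ_last] at this
    exact_mod_cast this
  rcases le_total t 0 with ht | ht
  · have : clamp01 t = 0 := le_antisymm (clamp01_le le_rfl ht) (clamp01_mem t).1
    rw [this]
    refine Finset.sum_congr rfl fun k _ => ?_
    rw [min_eq_left (h0 _), min_eq_left (h0 _), min_eq_left (ht.trans (h0 _)),
      min_eq_left (ht.trans (h0 _)), sub_self, sub_self]
  · rcases le_total t 1 with ht1 | ht1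
    · rw [clamp01_of_mem ⟨ht, ht1⟩]
    · have : clamp01 t = 1 := le_antisymm (clamp01_mem t).2 (le_clamp01 le_rfl ht1)
      rw [this]
      refine Finset.sum_congr rfl fun k _ => ?_
      rw [min_eq_right (h1 _), min_eq_right (h1 _), min_eq_right ((h1 _).trans ht1),
        min_eq_right ((h1 _).trans ht1)]

lemma exists_follows {φ : V →ₗ[ℝ] ℝ} (hφ : ∀ i, φ (K.α i) = 1)
    (π : K.LSData (C.ν 0)) : ∃ N b, C.Follows N b π.path := by
  obtain ⟨w, hw, hw0⟩ := π.mem ⟨0, π.spos⟩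
  obtain ⟨m, hm⟩ := C.exists_weyl_ν hw 0
  rw [hm] at hw0
  have hτ01 : ∀ (u : ℕ) (h : u + 1 < π.s),
      0 < π.τ ⟨u + 1, Nat.lt_succ_of_lt h⟩ ∧ π.τ ⟨u + 1, Nat.lt_succ_of_lt h⟩ < 1 := by
    intro u h
    rw [← π.τ_zero, ← π.τ_last]
    exact ⟨π.τ_mono (Fin.lt_def.2 (by simp)), π.τ_mono (Fin.lt_def.2 (by simpa using h))⟩
  have hν : ∀ (u : ℕ) (h : u < π.s), π.ν ⟨u, h⟩ = C.ν (m - u) := by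
    intro u
    induction u with
    | zero => intro h; simpa using hw0
    | succ u ih =>
      intro h
      have hc := π.chainCond u h
      rw [ih (by omega)] at hc
      rw [(C.sigmaChain_ν hφ (hτ01 u h).1 (hτ01 u h).2 hc).1]
      congr 1
      push_cast
      ring
  have hint : ∀ (u : ℕ) (h : u + 1 < π.s),
      ∃ z : ℤ, (C.c (m - (u + 1 : ℕ)) : ℝ) * π.τ ⟨u + 1, Nat.lt_succ_of_lt h⟩ = z := by
    intro u h
    have hc := π.chainCond u h
    rw [hν u (by omega)] at hc
    have := (C.sigmaChain_ν hφ (hτ01 u h).1 (hτ01 u h).2 hc).2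
    rwa [show m - (u + 1 : ℕ) = m - u - 1 by push_cast; ring]
  set T : ℤ → ℝ := fun j => (π.τ ⟨min π.s j.toNat, by omega⟩ : ℚ) with hT
  have hTmono : Monotone T := fun i j hij => by
    simp only [hT]
    exact_mod_cast π.τ_mono.monotone (Fin.le_def.2 (by simp only; omega))
  have hT0 : ∀ j ≤ 0, T j = 0 := by
    intro j hj
    have : (⟨min π.s j.toNat, by omega⟩ : Fin (π.s + 1)) = 0 := by
      ext
      simp
      omega
    simp only [hT, this, π.τ_zero, Rat.cast_zero]
  have hT1 : ∀ j, (π.s : ℤ) ≤ j → T j = 1 := by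
    intro j hj
    have : (⟨min π.s j.toNat, by omega⟩ : Fin (π.s + 1)) = Fin.last π.s := by
      ext
      simp
      omega
    simp only [hT, this, π.τ_last, Rat.cast_one]
  refine ⟨m.natAbs + π.s, fun l => T (m - l), ⟨?_, ?_, ?_, ?_, ?_, path_clamp π, ?_⟩⟩
  · exact fun x y hxy => hTmono (by omega)
  · intro l
    rcases le_or_gt (m - l) 0 with h | h
    · exact ⟨0, by simp [hT0 _ h]⟩
    rcases le_or_gt (π.s : ℤ) (m - l) with h' | h'
    · exact ⟨C.c l, by simp [hT1 _ h']⟩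
    obtain ⟨u, rfl⟩ : ∃ u : ℕ, l = m - (u + 1 : ℕ) := ⟨(m - l - 1).toNat, by omega⟩
    rw [sub_sub_cancel] at h h' ⊢
    have h'' : u + 1 < π.s := by exact_mod_cast h'
    obtain ⟨z, hz⟩ := hint u h''
    refine ⟨z, ?_⟩
    rw [← hz]
    simp only [hT, Int.toNat_natCast, min_eq_right h''.le]
  · exact fun l hl => hT0 _ (by omega)
  · exact fun l hl => hT1 _ (by omega)
  · refine Finset.sum_eq_zero fun k _ => ?_
    have h0 : ∀ i, (0 : ℝ) ≤ (π.τ i : ℚ) := fun i => by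
      have := π.τ_mono.monotone (Fin.zero_le i)
      rw [π.τ_zero] at this
      exact_mod_cast this
    rw [min_eq_left (h0 _), min_eq_left (h0 _)]
    simp
  · intro l t ht
    have triv : T (m - (l - 1)) = T (m - l) →
        π.path t = π.path (T (m - l)) + (t - T (m - l)) • C.ν l := by
      intro he
      rw [he] at ht
      rw [le_antisymm ht.2 ht.1]
      simp
    rcases lt_or_ge (m - l) 0 with h | h
    · exact triv (by rw [hT0 _ h.le, hT0 _ (by omega)])
    rcases le_or_gt (π.s : ℤ) (m - l) with h' | h'
    · exact triv (by rw [hT1 _ h', hT1 _ (by omega)])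
    obtain ⟨u, rfl⟩ : ∃ u : ℕ, l = m - u := ⟨(m - l).toNat, by omega⟩
    have hu : u < π.s := by omega
    have e1 : T (m - (m - u)) = (π.τ (Fin.castSucc ⟨u, hu⟩) : ℚ) := by
      simp only [hT, sub_sub_cancel, Int.toNat_natCast, min_eq_right hu.le]
      rfl
    have e2 : T (m - (m - u - 1)) = (π.τ (Fin.succ ⟨u, hu⟩) : ℚ) := by
      have : m - (m - (u : ℤ) - 1) = (u + 1 : ℕ) := by push_cast; ring
      simp only [hT, this, Int.toNat_natCast, min_eq_right (Nat.succ_le_of_lt hu)]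
      rfl
    rw [e1, e2] at ht
    rw [e1, path_seg π ⟨u, hu⟩ ht, hν]

end Orbit

end OrbitChain

/-- The sequence `1, b - 1, a (b - 1) - 1, …` satisfying `c (n + 2) = x * c (n + 1) - c n`, with
`x` alternating between `a` and `b`. -/
def coeffNat (a b : ℤ) : ℕ → ℤ
  | 0 => 1
  | 1 => b - 1
  | n + 2 => (if Even n then a else b) * coeffNat a b (n + 1) - coeffNat a b n

lemma coeffNat_pos_and_le {a b : ℤ} (ha : 2 ≤ a) (hb : 2 ≤ b) (n : ℕ) :
    0 < coeffNat a b n ∧ coeffNat a b n ≤ coeffNat a b (n + 1) := by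
  induction n with
  | zero => simp only [coeffNat]; omega
  | succ n ih =>
    refine ⟨by omega, ?_⟩
    rw [coeffNat]
    split_ifs <;> nlinarith

/-- The coefficients of the weights in the orbit of `Λ₁ - Λ₂`. -/
def coeff (a₁ a₂ : ℤ) : ℤ → ℤ
  | Int.ofNat n => coeffNat a₁ a₂ n
  | Int.negSucc n => coeffNat a₂ a₁ n

lemma coeff_pos {a₁ a₂ : ℤ} (ha₁ : 2 ≤ a₁) (ha₂ : 2 ≤ a₂) (l : ℤ) : 0 < coeff a₁ a₂ l := by
  cases l with
  | ofNat n => exact (coeffNat_pos_and_le ha₁ ha₂ n).1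
  | negSucc n => exact (coeffNat_pos_and_le ha₂ ha₁ n).1

lemma coeff_add (a₁ a₂ l : ℤ) :
    coeff a₁ a₂ (l - 1) + coeff a₁ a₂ (l + 1) = (if Even l then a₂ else a₁) * coeff a₁ a₂ l := by
  rcases l with (_ | n) | (_ | n)
  · change coeffNat a₂ a₁ 0 + coeffNat a₁ a₂ 1 = _ * coeffNat a₁ a₂ 0
    simp [coeffNat]
  · have e : (Int.ofNat (n + 1) - 1 : ℤ) = Int.ofNat n := by simp
    rw [e]
    change coeffNat a₁ a₂ n + coeffNat a₁ a₂ (n + 2) = _ * coeffNat a₁ a₂ (n + 1)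
    rw [coeffNat]
    by_cases h : Even n <;> simp [h, parity_simps]
  · change coeffNat a₂ a₁ 1 + coeffNat a₁ a₂ 0 = _ * coeffNat a₂ a₁ 0
    simp [coeffNat]
  · change coeffNat a₂ a₁ (n + 2) + coeffNat a₂ a₁ n = _ * coeffNat a₂ a₁ (n + 1)
    rw [coeffNat]
    by_cases h : Even n <;> simp [h, Int.negSucc_eq, parity_simps]

lemma isCoprime_coeff (a₁ a₂ l : ℤ) : IsCoprime (coeff a₁ a₂ l) (coeff a₁ a₂ (l + 1)) := by
  induction l using Int.induction_on with
  | zero => exact isCoprime_one_left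
  | succ n ih =>
    have h := coeff_add a₁ a₂ (n + 1)
    rw [add_sub_cancel_right] at h
    rw [← eq_sub_iff_add_eq'] at h
    rw [h, mul_comm, sub_eq_neg_add]
    exact IsCoprime.add_mul_left_right (ih.symm.neg_right) _
  | pred n ih =>
    have h := coeff_add a₁ a₂ (-n)
    rw [← eq_sub_iff_add_eq] at h
    rw [sub_add_cancel, h, mul_comm, sub_eq_neg_add]
    exact IsCoprime.add_mul_left_left (ih.symm.neg_left) _

/-- The Weyl group orbit of `Λ₁ - Λ₂` as a chain. -/
def orbitChain {V : Type*} [AddCommGroup V] [Module ℝ V] (K : KacMoodyData (Fin 2) V) {a₁ a₂ : ℤ}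
    (ha₁ : 2 ≤ a₁) (ha₂ : 2 ≤ a₂) (Λ : Fin 2 → V)
    (hpair : ∀ i j, K.coroot i (Λ j) = if i = j then 1 else 0)
    (hα₁ : K.α 0 = (2 : ℝ) • Λ 0 - (a₂ : ℝ) • Λ 1)
    (hα₂ : K.α 1 = (2 : ℝ) • Λ 1 - (a₁ : ℝ) • Λ 0) : OrbitChain K where
  ix l := if Even l then 0 else 1
  c := coeff a₁ a₂
  ν l := (coeff a₁ a₂ l : ℝ) • Λ (if Even l then 0 else 1)
    - (coeff a₁ a₂ (l - 1) : ℝ) • Λ (if Even l then 1 else 0)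
  ix_add_two l := by simp [parity_simps]
  c_pos := coeff_pos ha₁ ha₂
  c_zero := rfl
  c_neg_one := rfl
  c_dvd l := ⟨_, (coeff_add a₁ a₂ l).trans (mul_comm _ _)⟩
  c_coprime := isCoprime_coeff a₁ a₂
  ν_succ l := by
    have h := coeff_add a₁ a₂ l
    have h' : (coeff a₁ a₂ (l + 1) : ℝ) =
        (if Even l then a₂ else a₁ : ℤ) * coeff a₁ a₂ l - coeff a₁ a₂ (l - 1) := by
      rw [← eq_sub_iff_add_eq'] at h
      rw [h]
      push_cast
      rfl
    rw [h', add_sub_cancel_right]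
    by_cases hl : Even l
    · simp only [hl, if_true, Int.even_add_one, not_true, if_false, hα₁]
      module
    · simp only [hl, if_true, Int.even_add_one, not_false_iff, if_false, hα₂]
      module
  pair l := by
    by_cases hl : Even l <;> simp [hl, hpair]
  ix_ne l := by
    by_cases hl : Even l <;> simp [hl]

lemma exists_height {V : Type*} [AddCommGroup V] [Module ℝ V] (K : KacMoodyData (Fin 2) V)
    {a₁ a₂ : ℤ} (h4 : 4 < a₁ * a₂) (hA : K.a = ![![2, -a₁], ![-a₂, 2]]) :
    ∃ φ : V →ₗ[ℝ] ℝ, ∀ i, φ (K.α i) = 1 := by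
  have h : (4 : ℝ) - a₁ * a₂ ≠ 0 := by
    have : (4 : ℝ) < a₁ * a₂ := by exact_mod_cast h4
    linarith
  obtain ⟨u, hu⟩ : ∃ u : ℝ, u * (4 - a₁ * a₂) = 1 := ⟨_, inv_mul_cancel₀ h⟩
  refine ⟨((2 + a₂) * u : ℝ) • K.coroot 0 + ((2 + a₁) * u : ℝ) • K.coroot 1, fun i => ?_⟩
  fin_cases i <;> simp [K.cartanPairing, hA] <;> linear_combination hu

end LSPaper

open LSPaper in
theorem statement14 {V : Type*} [AddCommGroup V] [Module ℝ V]
    (K : KacMoodyData (Fin 2) V) (a₁ a₂ : ℤ) (ha₁ : 2 ≤ a₁) (ha₂ : 2 ≤ a₂)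
    (h4 : 4 < a₁ * a₂) (hA : K.a = ![![2, -a₁], ![-a₂, 2]])
    (Λ : Fin 2 → V) (hΛP : ∀ j, Λ j ∈ K.P)
    (hpair : ∀ i j, K.coroot i (Λ j) = if i = j then 1 else 0)
    (hgen : ∀ v ∈ K.P, ∃ c₁ c₂ : ℤ, v = c₁ • Λ 0 + c₂ • Λ 1)
    (hα₁ : K.α 0 = (2 : ℝ) • Λ 0 - (a₂ : ℝ) • Λ 1)
    (hα₂ : K.α 1 = (2 : ℝ) • Λ 1 - (a₁ : ℝ) • Λ 0) :
    ∀ f ∈ K.B (Λ 0 - Λ 1), ∃ word : List (Fin 2 × Bool),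
      K.applyWord word (some (straight (Λ 0 - Λ 1))) = some f := by
  obtain ⟨φ, hφ⟩ := exists_height K h4 hA
  let C := orbitChain K ha₁ ha₂ Λ hpair hα₁ hα₂
  have hν : C.ν 0 = Λ 0 - Λ 1 := by
    simp [C, orbitChain, show coeff a₁ a₂ 0 = 1 from rfl, show coeff a₁ a₂ (-1) = 1 from rfl]
  rw [← hν]
  rintro f ⟨π, rfl⟩
  obtain ⟨N, b, h⟩ := C.exists_follows hφ π
  exact h.exists_word
end
end

section
/- In the rank-2 hyperbolic setting with λ = Λ₁ − Λ₂: the straight-line path π_λ is the unique LS path of shape λ of weight λ; that is, if π ∈ B(λ) satisfies wt(π) = π(1) = λ, then π = π_λ. -/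
open scoped Classical
noncomputable section

namespace LSPaper

namespace KacMoodyData

section General

variable {I V : Type*} [Fintype I] [DecidableEq I] [AddCommGroup V] [Module ℝ V]
  (K : KacMoodyData I V)

lemma refl_apply (i : I) (x : V) : K.refl i x = x - K.coroot i x • K.α i := rfl

lemma refl_refl (i : I) (x : V) : K.refl i (K.refl i x) = x := K.reflMap_invol i x

lemma refl_mem_weylGroup (i : I) : K.refl i ∈ K.weylGroup :=
  Subgroup.subset_closure ⟨i, rfl⟩

/-- A set stable under the simple reflections is stable under the Weyl group. -/
lemma weylGroup_apply_mem {S : Set V} (hS : ∀ i, ∀ x ∈ S, K.refl i x ∈ S)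
    {w : V ≃ₗ[ℝ] V} (hw : w ∈ K.weylGroup) {x : V} (hx : x ∈ S) : w x ∈ S := by
  suffices h : ∀ x ∈ S, w x ∈ S ∧ w⁻¹ x ∈ S from (h x hx).1
  clear hx x
  induction hw using Subgroup.closure_induction with
  | mem w hw =>
    obtain ⟨i, rfl⟩ := hw
    exact fun x hx => ⟨hS i x hx, hS i x hx⟩
  | one => exact fun x hx => ⟨hx, hx⟩
  | mul w₁ w₂ _ _ h₁ h₂ =>
    intro x hx
    refine ⟨(h₁ _ (h₂ x hx).1).1, ?_⟩
    rw [mul_inv_rev]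
    exact (h₂ _ (h₁ x hx).2).2
  | inv w _ h => exact fun x hx => ⟨(h x hx).2, by rw [inv_inv]; exact (h x hx).1⟩

lemma weylGroup_symm_apply_mem {S : Set V} (hS : ∀ i, ∀ x ∈ S, K.refl i x ∈ S)
    {w : V ≃ₗ[ℝ] V} (hw : w ∈ K.weylGroup) {x : V} (hx : x ∈ S) : w.symm x ∈ S :=
  K.weylGroup_apply_mem hS (K.weylGroup.inv_mem hw) hx

lemma refl_mem_P (i : I) (x : V) (hx : x ∈ K.P) : K.refl i x ∈ K.P := by
  obtain ⟨n, hn⟩ := K.pairingInt i x hx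
  rw [refl_apply, hn, Int.cast_smul_eq_zsmul]
  exact K.P.sub_mem hx (K.P.zsmul_mem (K.rootMem i) n)

lemma stepDown_refl {i : I} {x : V} (hx : K.coroot i x < 0) : K.StepDown x (K.refl i x) := by
  refine ⟨1, K.weylGroup.one_mem, i, ⟨Pi.single i 1, ?_⟩, hx, rfl⟩
  rw [Finset.sum_eq_single i] <;> simp +contextual

lemma chainLen_zero (x : V) : K.chainLen 0 x x := ⟨fun _ => x, rfl, rfl, by simp⟩

lemma StepDown.chainLen_one {K : KacMoodyData I V} {x y : V} (h : K.StepDown x y) :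
    K.chainLen 1 x y := by
  refine ⟨fun n => if n = 0 then x else y, rfl, rfl, fun q hq => ?_⟩
  obtain rfl : q = 0 := by omega
  simpa using h

lemma chainLen.trans {K : KacMoodyData I V} {p q : ℕ} {x y z : V} (hp : K.chainLen p x y)
    (hq : K.chainLen q y z) : K.chainLen (p + q) x z := by
  obtain ⟨ξ, h0, h1, hs⟩ := hp
  obtain ⟨η, k0, k1, ks⟩ := hq
  refine ⟨fun n => if n < p then ξ n else η (n - p), ?_, by simp [k1], fun n hn => ?_⟩
  · rcases Nat.eq_zero_or_pos p with rfl | hp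
    · simp [k0, ← h1, h0]
    · simp [hp, h0]
  · rcases lt_trichotomy (n + 1) p with h | h | h
    · simpa [h, Nat.lt_of_succ_lt h] using hs n (by omega)
    · have := hs n (by omega)
      rw [h, h1, ← k0] at this
      simpa [h, show n < p by omega] using this
    · have := ks (n - p) (by omega)
      rw [show n - p + 1 = n + 1 - p by omega] at this
      simpa [show ¬ n + 1 < p by omega, show ¬ n < p by omega] using this

/-- A chain between elements at distance one has length at most one. -/
lemma chainLen.le_one_of_dist {K : KacMoodyData I V} {p : ℕ} {x y : V}
    (hp : K.chainLen p x y) (h : K.dist x y = 1) : p ≤ 1 := by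
  by_cases hb : BddAbove {p | K.chainLen p x y}
  · exact h ▸ le_csSup hb hp
  · rw [dist, csSup_of_not_bddAbove hb] at h
    simp at h

end General

section RankTwo

variable {V : Type*} [AddCommGroup V] [Module ℝ V] (K : KacMoodyData (Fin 2) V)

/-- The sequence `i, i + 1, i, i + 1, …` of indices. -/
def altIdx (i : Fin 2) : ℕ → Fin 2
  | 0 => i
  | n + 1 => altIdx i n + 1

/-- The sequence `μ, r_i μ, r_{i+1} r_i μ, …` obtained by applying the two simple reflections
alternately, starting with `r_i`. -/
def altSeq (i : Fin 2) (μ : V) : ℕ → V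
  | 0 => μ
  | n + 1 => K.refl (altIdx i n) (altSeq i μ n)

variable {K} {i : Fin 2} {μ : V}

lemma altSeq_pairing (hK : ∀ j, K.coroot (j + 1) (K.α j) ≤ -2)
    (h0 : 1 ≤ K.coroot i μ) (h1 : -K.coroot i μ ≤ K.coroot (i + 1) μ) (n : ℕ) :
    1 ≤ K.coroot (altIdx i n) (K.altSeq i μ n) ∧
      -K.coroot (altIdx i n) (K.altSeq i μ n) ≤ K.coroot (altIdx i n + 1) (K.altSeq i μ n) := by
  induction n with
  | zero => simpa [altSeq, altIdx] using ⟨h0, h1⟩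
  | succ n ih =>
    obtain ⟨hp, hq⟩ := ih
    have h2 : K.coroot (altIdx i n) (K.α (altIdx i n)) = 2 := by
      simp [K.cartanPairing, K.diag]
    have hidx : altIdx i n + 1 + 1 = altIdx i n := by
      rw [add_assoc, show (1 : Fin 2) + 1 = 0 from rfl, add_zero]
    have := hK (altIdx i n)
    simp only [altSeq, refl_apply, altIdx, hidx, map_sub,
      map_smul, smul_eq_mul, h2]
    constructor <;> nlinarith

lemma altSeq_height (hK : ∀ j, K.coroot (j + 1) (K.α j) ≤ -2)
    (h0 : 1 ≤ K.coroot i μ) (h1 : -K.coroot i μ ≤ K.coroot (i + 1) μ)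
    {h : V →ₗ[ℝ] ℝ} (hh : ∀ j, h (K.α j) = 1) (n : ℕ) :
    h (K.altSeq i μ n) ≤ h μ - n := by
  induction n with
  | zero => simp [altSeq]
  | succ n ih =>
    have := (altSeq_pairing hK h0 h1 n).1
    simp only [altSeq, refl_apply, map_sub, map_smul, smul_eq_mul, hh, Nat.cast_add, Nat.cast_one]
    linarith

lemma refl_altSeq_succ (i : Fin 2) (μ : V) (n : ℕ) :
    K.refl (altIdx i n) (K.altSeq i μ (n + 1)) = K.altSeq i μ n :=
  K.refl_refl _ _

/-- A simple reflection moves an alternating sequence by one position, except possibly at its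
origin. -/
lemma refl_altSeq (i : Fin 2) (μ : V) (j : Fin 2) (n : ℕ) :
    (∃ m, K.refl j (K.altSeq i μ n) = K.altSeq i μ m) ∨ (n = 0 ∧ j = i + 1) := by
  have hj : ∀ k : Fin 2, j = k ∨ j = k + 1 := by revert j; decide
  rcases n with _ | n
  · rcases hj i with rfl | rfl
    · exact Or.inl ⟨1, by simp [altSeq, altIdx]⟩
    · exact Or.inr ⟨rfl, rfl⟩
  · rcases hj (altIdx i n) with rfl | rfl
    · exact Or.inl ⟨n, refl_altSeq_succ i μ n⟩
    · exact Or.inl ⟨n + 2, by simp [altSeq, altIdx]⟩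

lemma chainLen_altSeq (hK : ∀ j, K.coroot (j + 1) (K.α j) ≤ -2)
    (h0 : 1 ≤ K.coroot i μ) (h1 : -K.coroot i μ ≤ K.coroot (i + 1) μ) (n : ℕ) :
    K.chainLen n (K.altSeq i μ n) μ := by
  induction n with
  | zero => exact K.chainLen_zero μ
  | succ n ih =>
    have hp := (altSeq_pairing hK h0 h1 n).1
    have hneg : K.coroot (altIdx i n) (K.altSeq i μ (n + 1)) < 0 := by
      have h2 : K.coroot (altIdx i n) (K.α (altIdx i n)) = 2 := by simp [K.cartanPairing, K.diag]
      simp only [altSeq, refl_apply, map_sub, map_smul, smul_eq_mul, h2]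
      linarith
    have hs := (K.stepDown_refl hneg).chainLen_one
    rw [refl_altSeq_succ] at hs
    exact add_comm 1 n ▸ hs.trans ih

lemma chainLen_neg_altSeq (hK : ∀ j, K.coroot (j + 1) (K.α j) ≤ -2)
    (h0 : 1 ≤ K.coroot i μ) (h1 : -K.coroot i μ ≤ K.coroot (i + 1) μ) (n : ℕ) :
    K.chainLen n (-μ) (-K.altSeq i μ n) := by
  induction n with
  | zero => exact K.chainLen_zero (-μ)
  | succ n ih =>
    have hp := (altSeq_pairing hK h0 h1 n).1
    have hneg : K.coroot (altIdx i n) (-K.altSeq i μ n) < 0 := by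
      rw [map_neg]
      linarith
    have hs := (K.stepDown_refl hneg).chainLen_one
    rw [map_neg] at hs
    exact ih.trans hs

variable {lam : V}

/-- The orbit of a weight consists of two alternating sequences. -/
lemma orbit_subset_altSeq {x : V} (hx : x ∈ K.orbit lam) :
    (∃ n, x = K.altSeq 0 lam n) ∨ ∃ n, x = -K.altSeq 1 (-lam) n := by
  obtain ⟨w, hw, rfl⟩ := hx
  refine K.weylGroup_apply_mem
    (S := {x | (∃ n, x = K.altSeq 0 lam n) ∨ ∃ n, x = -K.altSeq 1 (-lam) n}) ?_ hw
    (Or.inl ⟨0, rfl⟩)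
  rintro j x (⟨n, rfl⟩ | ⟨n, rfl⟩)
  · rcases refl_altSeq (K := K) 0 lam j n with h | ⟨rfl, rfl⟩
    · exact Or.inl h
    · exact Or.inr ⟨1, by simp [altSeq, altIdx]⟩
  · rcases refl_altSeq (K := K) 1 (-lam) j n with ⟨m, h⟩ | ⟨rfl, rfl⟩
    · exact Or.inr ⟨m, by rw [map_neg, h]⟩
    · exact Or.inl ⟨1, by simp [altSeq, altIdx]⟩

lemma orbit_step_mem {x : V} (hx : x ∈ K.orbit lam) {w : V ≃ₗ[ℝ] V} (hw : w ∈ K.weylGroup)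
    (i : Fin 2) : w (K.refl i (w.symm x)) ∈ K.orbit lam := by
  obtain ⟨w', hw', rfl⟩ := hx
  exact ⟨w * K.refl i * w⁻¹ * w', K.weylGroup.mul_mem (K.weylGroup.mul_mem
    (K.weylGroup.mul_mem hw (K.refl_mem_weylGroup i)) (K.weylGroup.inv_mem hw)) hw', rfl⟩

lemma height_nat {h : V →ₗ[ℝ] ℝ} (hh : ∀ j, h (K.α j) = 1) {v : V} (hv : v ∈ K.Qplus) :
    ∃ n : ℕ, h v = n := by
  obtain ⟨c, rfl⟩ := hv
  exact ⟨∑ i, c i, by simp [hh]⟩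

/-- A step of a `σ`-chain with `0 < σ < 1` in the orbit of a weight `lam` whose coordinates are
`(1, -1)` does not pass from one of the sets `{x > lam}`, `{lam}`, `{x < lam}` to another. -/
lemma sign_height_step (hK : ∀ j, K.coroot (j + 1) (K.α j) ≤ -2)
    (hP : lam ∈ K.P) (hl0 : K.coroot 0 lam = 1) (hl1 : K.coroot 1 lam = -1)
    {h : V →ₗ[ℝ] ℝ} (hh : ∀ j, h (K.α j) = 1) {σ : ℝ} (hσ0 : 0 < σ) (hσ1 : σ < 1)
    {x y : V} (hx : x ∈ K.orbit lam) (hd : K.dist x y = 1)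
    {w : V ≃ₗ[ℝ] V} (hw : w ∈ K.weylGroup) {i : Fin 2} (hβ : w (K.α i) ∈ K.Qplus)
    (hy : y = w (K.refl i (w.symm x))) {n : ℤ} (hn : n < 0)
    (hσn : σ * K.coroot i (w.symm x) = n) :
    SignType.sign (h x - h lam) = SignType.sign (h y - h lam) := by
  have hyo : y ∈ K.orbit lam := hy ▸ orbit_step_mem hx hw i
  obtain ⟨b, hb⟩ := height_nat hh hβ
  have hxP : x ∈ K.P := by
    obtain ⟨w', hw', rfl⟩ := hx
    exact K.weylGroup_apply_mem (S := (K.P : Set V)) K.refl_mem_P hw' hP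
  obtain ⟨c, hc⟩ := K.pairingInt i _
    (K.weylGroup_symm_apply_mem (S := (K.P : Set V)) K.refl_mem_P hw hxP)
  have hhy : h y = h x - c * b := by
    rw [hy, refl_apply, hc]
    simp [hb]
  rw [hc] at hσn
  have hn' : (n : ℝ) < 0 := by exact_mod_cast hn
  have hc0 : (c : ℝ) < 0 := by
    by_contra! hc'
    nlinarith
  have hxy : h x ≤ h y := by
    have : (0 : ℝ) ≤ b := b.cast_nonneg
    nlinarith
  have hne1 : h y - h x ≠ 1 := by
    intro h1
    have hcb : (-c) * (b : ℤ) = 1 := by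
      have : (-(c : ℝ)) * b = 1 := by linarith
      exact_mod_cast this
    have hc1 : c = -1 := by
      rcases Int.eq_one_or_neg_one_of_mul_eq_one hcb with h' | h'
      · omega
      · have : c < 0 := by exact_mod_cast hc0
        omega
    rw [hc1] at hσn
    have h2 : (n : ℝ) > (-1 : ℤ) := by push_cast at hσn ⊢; linarith
    have h3 : n > -1 := by exact_mod_cast h2
    omega
  have hu0 : (1 : ℝ) ≤ K.coroot 0 lam := hl0.ge
  have hu1 : -K.coroot 0 lam ≤ K.coroot (0 + 1) lam := by simp [hl0, hl1]
  have hd0 : (1 : ℝ) ≤ K.coroot 1 (-lam) := by simp [hl1]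
  have hd1 : -K.coroot 1 (-lam) ≤ K.coroot (1 + 1) (-lam) := by
    rw [show (1 : Fin 2) + 1 = 0 from rfl]
    simp [hl0, hl1]
  have hup := altSeq_height hK hu0 hu1 hh
  have hdown := altSeq_height hK hd0 hd1 hh
  have hcu := chainLen_altSeq hK hu0 hu1
  have hcd := chainLen_neg_altSeq hK hd0 hd1
  rw [neg_neg] at hcd
  have hu : h (K.altSeq 0 lam 1) = h lam - 1 := by simp [altSeq, altIdx, refl_apply, hl0, hh]
  have hv : h (-K.altSeq 1 (-lam) 1) = h lam + 1 := by
    simp [altSeq, altIdx, refl_apply, hl1, hh, add_comm]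
  rcases orbit_subset_altSeq hx with ⟨m, rfl⟩ | ⟨m, rfl⟩ <;>
    rcases orbit_subset_altSeq hyo with ⟨k, rfl⟩ | ⟨k, rfl⟩
  · have hm := hup m
    have hk := hup k
    rcases Nat.eq_zero_or_pos m with rfl | hm0
    · rcases Nat.eq_zero_or_pos k with rfl | hk0
      · rfl
      · have : (1 : ℝ) ≤ k := by exact_mod_cast hk0
        simp only [altSeq] at hxy
        linarith
    · rcases Nat.eq_zero_or_pos k with rfl | hk0
      · obtain rfl : m = 1 := le_antisymm ((hcu m).le_one_of_dist hd) hm0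
        simp only [altSeq] at hne1 hu
        exact absurd (by linarith) hne1
      · have h1 : (1 : ℝ) ≤ k := by exact_mod_cast hk0
        have h2 : (1 : ℝ) ≤ m := by exact_mod_cast hm0
        rw [sign_neg (by linarith), sign_neg (by linarith)]
  · have hlen := ((hcu m).trans (hcd k)).le_one_of_dist hd
    rcases Nat.eq_zero_or_pos m with rfl | hm0
    · rcases Nat.eq_zero_or_pos k with rfl | hk0
      · simp [altSeq]
      · obtain rfl : k = 1 := by omega
        rw [hv] at hne1
        simp [altSeq] at hne1
    · obtain rfl : m = 1 := by omega
      obtain rfl : k = 0 := by omega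
      rw [hu] at hne1
      simp [altSeq] at hne1
  · have hm := hdown m
    have hk := hup k
    simp only [map_neg] at hm hxy
    have h1 : (0 : ℝ) ≤ m := m.cast_nonneg
    have h2 : (0 : ℝ) ≤ k := k.cast_nonneg
    rw [map_neg, show h (K.altSeq 0 lam k) = -h (K.altSeq 1 (-lam) m) by linarith]
  · have hm := hdown m
    have hk := hdown k
    rw [map_neg] at hm hk
    rcases Nat.eq_zero_or_pos m with rfl | hm0
    · have hlen := (hcd k).le_one_of_dist (by simpa [altSeq] using hd)
      rcases Nat.eq_zero_or_pos k with rfl | hk0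
      · rfl
      · obtain rfl : k = 1 := by omega
        rw [hv] at hne1
        simp [altSeq] at hne1
    · rcases Nat.eq_zero_or_pos k with rfl | hk0
      · have : (1 : ℝ) ≤ m := by exact_mod_cast hm0
        simp only [altSeq, map_neg, neg_neg] at hxy
        linarith
      · have h1 : (1 : ℝ) ≤ k := by exact_mod_cast hk0
        have h2 : (1 : ℝ) ≤ m := by exact_mod_cast hm0
        simp only [map_neg]
        rw [sign_pos (by linarith), sign_pos (by linarith)]

/-- The height determines `lam` inside its orbit. -/
lemma eq_of_height_eq (hK : ∀ j, K.coroot (j + 1) (K.α j) ≤ -2)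
    (hl0 : K.coroot 0 lam = 1) (hl1 : K.coroot 1 lam = -1)
    {h : V →ₗ[ℝ] ℝ} (hh : ∀ j, h (K.α j) = 1) {x : V} (hx : x ∈ K.orbit lam)
    (hxl : h x = h lam) : x = lam := by
  rcases orbit_subset_altSeq hx with ⟨m, rfl⟩ | ⟨m, rfl⟩
  · have hm := altSeq_height hK hl0.ge (i := 0) (by simp [hl0, hl1]) hh m
    have : (m : ℝ) ≤ 0 := by linarith
    obtain rfl : m = 0 := Nat.le_zero.mp (by exact_mod_cast this)
    rfl
  · have hm := altSeq_height hK (i := 1) (μ := -lam) (by simp [hl1])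
      (by rw [show (1 : Fin 2) + 1 = 0 from rfl]; simp [hl0, hl1]) hh m
    simp only [map_neg] at hm hxl
    have : (m : ℝ) ≤ 0 := by linarith
    obtain rfl : m = 0 := Nat.le_zero.mp (by exact_mod_cast this)
    simp [altSeq]

/-- All the directions of an LS path of shape `lam` lie on the same side of `lam`. -/
lemma LSData.sign_height_eq (π : K.LSData lam)
    (hK : ∀ j, K.coroot (j + 1) (K.α j) ≤ -2)
    (hP : lam ∈ K.P) (hl0 : K.coroot 0 lam = 1) (hl1 : K.coroot 1 lam = -1)
    {h : V →ₗ[ℝ] ℝ} (hh : ∀ j, h (K.α j) = 1) (u : ℕ) (hu : u < π.s) :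
    SignType.sign (h (π.ν ⟨u, hu⟩) - h lam) =
      SignType.sign (h (π.ν ⟨0, π.spos⟩) - h lam) := by
  induction u with
  | zero => rfl
  | succ u ih =>
    rw [← ih (by omega)]
    obtain ⟨p, -, ξ, h0, hp, hstep⟩ := π.chainCond u hu
    have hσ0 : (0 : ℝ) < π.τ ⟨u + 1, by omega⟩ := by
      have : π.τ 0 < π.τ ⟨u + 1, by omega⟩ := π.τ_mono (by simp [Fin.lt_def])
      rw [π.τ_zero] at this
      exact_mod_cast this
    have hσ1 : (π.τ ⟨u + 1, by omega⟩ : ℝ) < 1 := by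
      have : π.τ ⟨u + 1, by omega⟩ < π.τ (Fin.last _) := π.τ_mono (by simp [Fin.lt_def, hu])
      rw [π.τ_last] at this
      exact_mod_cast this
    have key : ∀ q ≤ p, ξ q ∈ K.orbit lam ∧
        SignType.sign (h (ξ q) - h lam) = SignType.sign (h (ξ 0) - h lam) := by
      intro q hq
      induction q with
      | zero => exact ⟨h0 ▸ π.mem _, rfl⟩
      | succ q ihq =>
        obtain ⟨hmem, hsign⟩ := ihq (by omega)
        obtain ⟨hd, w, hw, i, hβ, hy, n, hn, hσn⟩ := hstep q hq
        exact ⟨hy ▸ orbit_step_mem hmem hw i, by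
          rw [← hsign, sign_height_step hK hP hl0 hl1 hh hσ0 hσ1 hmem hd hw hβ hy hn hσn]⟩
    rw [← hp, ← h0]
    exact (key p le_rfl).2

end RankTwo

namespace LSData

variable {I V : Type*} [Fintype I] [DecidableEq I] [AddCommGroup V] [Module ℝ V]
  {K : KacMoodyData I V} {μ : V} (π : K.LSData μ)

lemma sum_min_sub (t : ℝ) :
    ∑ k : Fin π.s, (min t (π.τ k.succ : ℝ) - min t (π.τ k.castSucc : ℝ)) = clamp01 t := by
  have h := (Fin.sum_univ_succ fun k => min t (π.τ k : ℝ)).symm.trans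
    (Fin.sum_univ_castSucc fun k => min t (π.τ k : ℝ))
  have hl : min t 1 - min t 0 = clamp01 t := by
    rw [clamp01, min_comm 1 t]
    rcases le_total t 0 with h0 | h0
    · rw [min_eq_left h0, min_eq_left (h0.trans zero_le_one), max_eq_left h0, sub_self]
    · rw [min_eq_right h0, max_eq_right (le_min h0 zero_le_one), sub_zero]
  simp only [π.τ_zero, π.τ_last, Rat.cast_zero, Rat.cast_one] at h
  rw [Finset.sum_sub_distrib, ← hl]
  linarith

lemma path_eq_straight (h : ∀ k, π.ν k = μ) : π.path = straight μ := by
  funext t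
  simp only [path, straight, h, ← Finset.sum_smul, sum_min_sub]

/-- A linear functional that is bounded below strictly on the directions of an LS path is
bounded below strictly on its weight. -/
lemma lt_apply_path_one (h : V →ₗ[ℝ] ℝ) {c : ℝ} (hc : ∀ k, c < h (π.ν k)) :
    c < h (π.path 1) := by
  have hone : ∑ k : Fin π.s, (min 1 (π.τ k.succ : ℝ) - min 1 (π.τ k.castSucc : ℝ)) = 1 := by
    rw [sum_min_sub]
    simp [clamp01]
  have hpos : ∀ k : Fin π.s, 0 < min 1 (π.τ k.succ : ℝ) - min 1 (π.τ k.castSucc : ℝ) := by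
    intro k
    have h1 : ∀ j, (π.τ j : ℝ) ≤ 1 := fun j => by
      have := π.τ_mono.monotone (Fin.le_last j)
      rw [π.τ_last] at this
      exact_mod_cast this
    rw [min_eq_right (h1 _), min_eq_right (h1 _), sub_pos]
    exact_mod_cast π.τ_mono k.castSucc_lt_succ
  simp only [path, map_sum, map_smul, smul_eq_mul]
  calc c = ∑ k : Fin π.s, (min 1 (π.τ k.succ : ℝ) - min 1 (π.τ k.castSucc : ℝ)) * c := by
        rw [← Finset.sum_mul, hone, one_mul]
    _ < _ := Finset.sum_lt_sum_of_nonempty ⟨⟨0, π.spos⟩, Finset.mem_univ _⟩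
        fun k _ => mul_lt_mul_of_pos_left (hc k) (hpos k)

end LSData

end KacMoodyData

end LSPaper

open LSPaper in
theorem statement15 {V : Type*} [AddCommGroup V] [Module ℝ V]
    (K : KacMoodyData (Fin 2) V) (a₁ a₂ : ℤ) (ha₁ : 2 ≤ a₁) (ha₂ : 2 ≤ a₂)
    (h4 : 4 < a₁ * a₂) (hA : K.a = ![![2, -a₁], ![-a₂, 2]])
    (Λ : Fin 2 → V) (hΛP : ∀ j, Λ j ∈ K.P)
    (hpair : ∀ i j, K.coroot i (Λ j) = if i = j then 1 else 0)
    (hgen : ∀ v ∈ K.P, ∃ c₁ c₂ : ℤ, v = c₁ • Λ 0 + c₂ • Λ 1)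
    (hα₁ : K.α 0 = (2 : ℝ) • Λ 0 - (a₂ : ℝ) • Λ 1)
    (hα₂ : K.α 1 = (2 : ℝ) • Λ 1 - (a₁ : ℝ) • Λ 0) :
    ∀ f ∈ K.B (Λ 0 - Λ 1), f 1 = Λ 0 - Λ 1 → f = straight (Λ 0 - Λ 1) := by
  rintro f ⟨π, rfl⟩ hwt
  have hc : ∀ i j, K.coroot i (K.α j) = ((![![2, -a₁], ![-a₂, 2]] : Fin 2 → Fin 2 → ℤ) i j : ℝ) :=
    fun i j => by rw [K.cartanPairing, hA]
  have h1 : (2 : ℝ) ≤ a₁ := by exact_mod_cast ha₁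
  have h2 : (2 : ℝ) ≤ a₂ := by exact_mod_cast ha₂
  have hD : (4 - a₁ * a₂ : ℝ) ≠ 0 := by
    have : (4 : ℝ) < a₁ * a₂ := by exact_mod_cast h4
    linarith
  have hK : ∀ j, K.coroot (j + 1) (K.α j) ≤ -2 := by
    intro j
    fin_cases j <;> simp [hc, h1, h2]
  have hP : Λ 0 - Λ 1 ∈ K.P := K.P.sub_mem (hΛP 0) (hΛP 1)
  have hl0 : K.coroot 0 (Λ 0 - Λ 1) = 1 := by simp [hpair]
  have hl1 : K.coroot 1 (Λ 0 - Λ 1) = -1 := by simp [hpair]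
  obtain ⟨h, hh⟩ : ∃ h : V →ₗ[ℝ] ℝ, ∀ j, h (K.α j) = 1 := by
    refine ⟨(4 - a₁ * a₂ : ℝ)⁻¹ • (((2 + a₂ : ℝ)) • K.coroot 0 + ((2 + a₁ : ℝ)) • K.coroot 1), ?_⟩
    intro j
    fin_cases j <;> simp [hc] <;> field_simp <;> ring
  have hsign : ∀ k, SignType.sign (h (π.ν k) - h (Λ 0 - Λ 1)) = _ :=
    fun k => π.sign_height_eq hK hP hl0 hl1 hh k k.2
  rcases lt_trichotomy (h (π.ν ⟨0, π.spos⟩) - h (Λ 0 - Λ 1)) 0 with h0 | h0 | h0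
  · rw [sign_neg h0] at hsign
    have := π.lt_apply_path_one (-h) (c := -h (Λ 0 - Λ 1)) fun k => by
      have := sign_eq_neg_one_iff.mp (hsign k)
      simp only [LinearMap.neg_apply]
      linarith
    rw [hwt] at this
    exact absurd this (lt_irrefl _)
  · rw [h0, sign_zero] at hsign
    exact π.path_eq_straight fun k =>
      KacMoodyData.eq_of_height_eq hK hl0 hl1 hh (π.mem k)
        (sub_eq_zero.mp (sign_eq_zero_iff.mp (hsign k)))
  · rw [sign_pos h0] at hsign
    have := π.lt_apply_path_one h (c := h (Λ 0 - Λ 1)) fun k =>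
      sub_pos.mp (sign_eq_one_iff.mp (hsign k))
    rw [hwt] at this
    exact absurd this (lt_irrefl _)
end
end
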